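/- arXiv:1309.5328 — 8 statements merged into one kernel-verified Lean document; each statement's English description precedes it below -/
import Mathlib

section
/- ψ(0) = 0 and the right derivative of ψ at 0 equals ∫ x λ(dx) in the following extended sense: (i) if x ↦ x is λ-integrable, then (ψ(β) − ψ(0))/β → ∫_ℝ x λ(dx) as β ↓ 0; (ii) if ∫_ℝ max(−x, 0) λ(dx) = +∞ (note that max(x,0) is always λ-integrable since supp λ ⊆ (−∞, h]), then ψ(β)/β → −∞ as β ↓ 0. -/
open MeasureTheory Filter

lemma abs_exp_sub_one_le_of_le {t c : ℝ} (hc : 0 ≤ c) (htc : t ≤ c) :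
    |Real.exp t - 1| ≤ |t| * Real.exp c := by
  rcases le_total 0 t with ht | ht
  · rw [abs_of_nonneg (by linarith [Real.add_one_le_exp t]), abs_of_nonneg ht]
    have h1 : Real.exp t * (1 - t) ≤ 1 := by
      calc Real.exp t * (1 - t) ≤ Real.exp t * Real.exp (-t) := by
            gcongr
            linarith [Real.add_one_le_exp (-t)]
        _ = 1 := by rw [← Real.exp_add]; simp
    have h2 : t * Real.exp t ≤ t * Real.exp c := by gcongr
    linarith
  · rw [abs_of_nonpos (by linarith [Real.exp_le_one_iff.2 ht]), abs_of_nonpos ht]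
    have h2 : -t * 1 ≤ -t * Real.exp c :=
      mul_le_mul_of_nonneg_left (Real.one_le_exp hc) (by linarith)
    linarith [Real.add_one_le_exp t]

/-- The exponential difference quotient is dominated, for functions bounded above. -/
lemma abs_exp_mul_sub_one_div_le {β y c : ℝ} (hβ : 0 < β) (hβ1 : β ≤ 1) (hc : 0 ≤ c)
    (hy : y ≤ c) : |(Real.exp (β * y) - 1) / β| ≤ |y| * Real.exp c := by
  rw [abs_div, abs_of_pos hβ, div_le_iff₀ hβ]
  have hle : β * y ≤ c := by nlinarith
  calc |Real.exp (β * y) - 1| ≤ |β * y| * Real.exp c := abs_exp_sub_one_le_of_le hc hle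
    _ = |y| * Real.exp c * β := by rw [abs_mul, abs_of_pos hβ]; ring

lemma tendsto_exp_mul_sub_one_div (y : ℝ) :
    Tendsto (fun β : ℝ => (Real.exp (β * y) - 1) / β) (nhdsWithin 0 (Set.Ioi 0)) (nhds y) := by
  have hd : HasDerivAt (fun β : ℝ => Real.exp (β * y)) y 0 := by
    simpa using ((hasDerivAt_id (0 : ℝ)).mul_const y).exp
  refine (hd.tendsto_slope_zero_right).congr fun β => ?_
  simp [div_eq_inv_mul]

lemma tendsto_integral_exp_mul_sub_one_div {α : Type*} [MeasurableSpace α] {μ : Measure α}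
    {f : α → ℝ} {c : ℝ} (hc : 0 ≤ c) (hf : Integrable f μ) (hfc : ∀ᵐ x ∂μ, f x ≤ c) :
    Tendsto (fun β : ℝ => (∫ x, (Real.exp (β * f x) - 1) ∂μ) / β)
      (nhdsWithin 0 (Set.Ioi 0)) (nhds (∫ x, f x ∂μ)) := by
  simp_rw [← integral_div]
  refine tendsto_integral_filter_of_dominated_convergence (fun x => |f x| * Real.exp c) ?_ ?_
    (hf.abs.mul_const _) (ae_of_all _ fun x => tendsto_exp_mul_sub_one_div (f x))
  · refine Eventually.of_forall fun β => ?_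
    have hm := (hf.aestronglyMeasurable.aemeasurable.const_mul β).exp
    exact ((hm.sub_const 1).div_const β).aestronglyMeasurable
  · filter_upwards [Ioc_mem_nhdsGT (zero_lt_one' ℝ)] with β hβ
    filter_upwards [hfc] with x hx
    exact abs_exp_mul_sub_one_div_le hβ.1 hβ.2 hc hx

lemma integrable_exp_mul_sub_one {α : Type*} [MeasurableSpace α] {μ : Measure α}
    [IsFiniteMeasure μ] {f : α → ℝ} {c β : ℝ} (hβ : 0 ≤ β) (hf : AEMeasurable f μ)
    (hfc : ∀ᵐ x ∂μ, f x ≤ c) : Integrable (fun x => Real.exp (β * f x) - 1) μ := by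
  refine Integrable.sub ?_ (integrable_const 1)
  refine Integrable.of_bound (hf.const_mul β).exp.aestronglyMeasurable (Real.exp (β * c)) ?_
  filter_upwards [hfc] with x hx
  rw [Real.norm_of_nonneg (Real.exp_pos _).le]
  gcongr

/-- Truncated integrals of a function with infinite integral are unbounded. -/
lemma exists_lt_integral_min {α : Type*} [MeasurableSpace α] {μ : Measure α}
    [IsFiniteMeasure μ] {g : α → ℝ} (hg : Measurable g) (hg0 : ∀ x, 0 ≤ g x)
    (htop : ∫⁻ x, ENNReal.ofReal (g x) ∂μ = ⊤) (C : ℝ) :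
    ∃ n : ℕ, C < ∫ x, min (g x) n ∂μ := by
  by_contra! hcon
  have hint (n : ℕ) : ∫⁻ x, ENNReal.ofReal (min (g x) n) ∂μ ≤ ENNReal.ofReal C := by
    rw [← ofReal_integral_eq_lintegral_ofReal]
    · exact ENNReal.ofReal_le_ofReal (hcon n)
    · refine Integrable.of_bound (hg.min measurable_const).aestronglyMeasurable (n : ℝ)
        (ae_of_all _ fun x => ?_)
      rw [Real.norm_of_nonneg (le_min (hg0 x) n.cast_nonneg)]
      exact min_le_right _ _
    · exact ae_of_all _ fun x => le_min (hg0 x) n.cast_nonneg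
  have hlim : Tendsto (fun n : ℕ => ∫⁻ x, ENNReal.ofReal (min (g x) n) ∂μ) atTop
      (nhds (∫⁻ x, ENNReal.ofReal (g x) ∂μ)) := by
    refine lintegral_tendsto_of_tendsto_of_monotone
      (fun n => (hg.min measurable_const).ennreal_ofReal.aemeasurable)
      (ae_of_all _ fun x m n hmn => ENNReal.ofReal_le_ofReal (by gcongr))
      (ae_of_all _ fun x => ?_)
    obtain ⟨N, hN⟩ := exists_nat_ge (g x)
    refine tendsto_const_nhds.congr' ?_
    filter_upwards [eventually_ge_atTop N] with n hn
    rw [min_eq_left (hN.trans (by exact_mod_cast hn))]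
  have hle := le_of_tendsto' hlim hint
  rw [htop, top_le_iff] at hle
  exact ENNReal.ofReal_ne_top hle

lemma tendsto_integral_exp_mul_sub_one_div_atBot {α : Type*} [MeasurableSpace α]
    {μ : Measure α} [IsFiniteMeasure μ] {f : α → ℝ} {c : ℝ} (hc : 0 ≤ c) (hf : Measurable f)
    (hfc : ∀ᵐ x ∂μ, f x ≤ c) (htop : ∫⁻ x, ENNReal.ofReal (max (-f x) 0) ∂μ = ⊤) :
    Tendsto (fun β : ℝ => (∫ x, (Real.exp (β * f x) - 1) ∂μ) / β)
      (nhdsWithin 0 (Set.Ioi 0)) atBot := by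
  refine tendsto_atBot.2 fun b => ?_
  obtain ⟨n, hn⟩ := exists_lt_integral_min (hf.neg.max measurable_const)
    (fun x => le_max_right _ _) htop (c * μ.real Set.univ - b)
  have hn0 : (0 : ℝ) ≤ n := n.cast_nonneg
  have hub : ∀ᵐ x ∂μ, max (f x) (-n) ≤ c := by
    filter_upwards [hfc] with x hx
    exact max_le hx (by linarith)
  have hfn : Integrable (fun x => max (f x) (-n)) μ := by
    refine Integrable.of_bound (hf.max measurable_const).aestronglyMeasurable (c + n) ?_
    filter_upwards [hub] with x hx
    rw [Real.norm_eq_abs, abs_le]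
    constructor <;> linarith [le_max_right (f x) (-n : ℝ)]
  have hmin : Integrable (fun x => min (max (-f x) 0) (n : ℝ)) μ := by
    refine Integrable.of_bound
      ((hf.neg.max measurable_const).min measurable_const).aestronglyMeasurable (n : ℝ)
      (ae_of_all _ fun x => ?_)
    rw [Real.norm_of_nonneg (le_min (le_max_right _ _) hn0)]
    exact min_le_right _ _
  have hlt : ∫ x, max (f x) (-n) ∂μ < b := by
    have hle : ∫ x, max (f x) (-n) ∂μ ≤ ∫ x, (c - min (max (-f x) 0) (n : ℝ)) ∂μ := by
      refine integral_mono_ae hfn ((integrable_const c).sub hmin) ?_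
      filter_upwards [hfc] with x hx
      change max (f x) (-n : ℝ) ≤ c - min (max (-f x) 0) (n : ℝ)
      rcases le_total 0 (f x) with h0 | h0
      · rw [max_eq_left (by linarith), max_eq_right (by linarith), min_eq_left hn0]
        linarith
      · rw [max_eq_left (by linarith : 0 ≤ -f x)]
        have h1 : -min (-f x) (n : ℝ) = max (f x) (-n) := by simp [← max_neg_neg]
        linarith
    rw [integral_sub (integrable_const c) hmin, integral_const, smul_eq_mul] at hle
    simp only [Pi.neg_apply] at hn
    linarith
  filter_upwards [(tendsto_integral_exp_mul_sub_one_div hc hfn hub).eventually_lt_const hlt,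
    self_mem_nhdsWithin] with β hβ hβ0
  have hβ0 : 0 < β := hβ0
  refine le_trans ?_ hβ.le
  refine div_le_div_of_nonneg_right (integral_mono ?_ ?_ fun x => ?_) hβ0.le
  · exact integrable_exp_mul_sub_one hβ0.le hf.aemeasurable hfc
  · exact integrable_exp_mul_sub_one hβ0.le (hf.max measurable_const).aemeasurable hub
  · dsimp only
    gcongr
    exact le_max_left _ _

lemma ae_le_of_measure_Ioi_zero_eq {μ : Measure ℝ} [IsFiniteMeasure μ] {h : ℝ} (hh : 0 < h)
    (hIoi : μ (Set.Ioi 0) = μ {h}) : ∀ᵐ x ∂μ, x ≤ h := by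
  have hdiff : μ (Set.Ioi 0 \ {h}) = 0 := by
    rw [measure_sdiff (Set.singleton_subset_iff.2 (Set.mem_Ioi.2 hh))
      (measurableSet_singleton h).nullMeasurableSet (measure_ne_top _ _), hIoi, tsub_self]
  refine measure_mono_null (fun x hx => ?_) hdiff
  have hx : h < x := not_le.1 hx
  exact ⟨hh.trans hx, hx.ne'⟩

/-- `ψ(0) = 0` and the right derivative of the Laplace exponent `ψ` at `0` equals
`∫ x λ(dx)` in the extended sense: if `x ↦ x` is `λ`-integrable then
`(ψ(β) − ψ(0))/β → ∫ x λ(dx)` as `β ↓ 0`; if `∫ max(−x,0) λ(dx) = +∞` then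
`ψ(β)/β → −∞` as `β ↓ 0`. -/
theorem stmt2 (h : ℝ) (hh : 0 < h) (lam : Measure ℝ) [IsFiniteMeasure lam] (hne : lam ≠ 0)
    (hzero : lam {0} = 0)
    (hsupp : lam {x : ℝ | ∀ k : ℤ, x ≠ k * h} = 0)
    (hIoi : lam (Set.Ioi (0 : ℝ)) = lam {h}) (hath : 0 < lam {h}) :
    (∫ x : ℝ, (Real.exp ((0 : ℝ) * x) - 1) ∂lam) = 0 ∧
    (Integrable (fun x : ℝ => x) lam →
      Tendsto
        (fun β : ℝ =>
          ((∫ x : ℝ, (Real.exp (β * x) - 1) ∂lam)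
            - (∫ x : ℝ, (Real.exp ((0 : ℝ) * x) - 1) ∂lam)) / β)
        (nhdsWithin 0 (Set.Ioi 0)) (nhds (∫ x : ℝ, x ∂lam))) ∧
    ((∫⁻ x : ℝ, ENNReal.ofReal (max (-x) 0) ∂lam = ⊤) →
      Tendsto (fun β : ℝ => (∫ x : ℝ, (Real.exp (β * x) - 1) ∂lam) / β)
        (nhdsWithin 0 (Set.Ioi 0)) atBot) := by
  have hle := ae_le_of_measure_Ioi_zero_eq hh hIoi
  refine ⟨by simp, fun hint => ?_, fun htop => ?_⟩
  · simpa using tendsto_integral_exp_mul_sub_one_div hh.le hint hle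
  · exact tendsto_integral_exp_mul_sub_one_div_atBot hh.le measurable_id hle htop
end

section
/- ψ(0) = 0, and the zeros of ψ on [0,∞) are classified as follows: (i) if x ↦ x is λ-integrable with ∫ x λ(dx) ≥ 0, then 0 is the only zero of ψ on [0,∞); (ii) if either x ↦ x is λ-integrable with ∫ x λ(dx) < 0, or ∫ max(−x,0) λ(dx) = +∞, then there is exactly one Φ₀ ∈ (0,∞) with ψ(Φ₀) = 0, and the zero set of ψ on [0,∞) is exactly {0, Φ₀}. -/
open MeasureTheory

open Filter Topology

lemma exp_mul_sub_one_lt {a b x : ℝ} (ha : 0 < a) (hab : a < b) (hx : x ≠ 0) :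
    Real.exp (a * x) - 1 < a / b * (Real.exp (b * x) - 1) := by
  have hb : 0 < b := ha.trans hab
  have hlt : a / b < 1 := (div_lt_one hb).2 hab
  have key := strictConvexOn_exp.2 (Set.mem_univ (b * x)) (Set.mem_univ (0 : ℝ))
    (mul_ne_zero hb.ne' hx) (div_pos ha hb) (sub_pos.2 hlt) (by ring)
  have hax : a / b * (b * x) = a * x := by field_simp
  simp only [smul_eq_mul, mul_zero, add_zero, Real.exp_zero, mul_one, hax] at key
  linarith

lemma exp_mul_sub_one_le {a b x : ℝ} (ha : 0 < a) (hab : a ≤ b) :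
    Real.exp (a * x) - 1 ≤ a / b * (Real.exp (b * x) - 1) := by
  rcases hab.eq_or_lt with rfl | hab
  · rw [div_self ha.ne', one_mul]
  rcases eq_or_ne x 0 with rfl | hx
  · simp
  · exact (exp_mul_sub_one_lt ha hab hx).le

lemma integral_lt_integral_of_ae_lt {μ : Measure ℝ} (hμ : μ ≠ 0) {f g : ℝ → ℝ}
    (hf : Integrable f μ) (hg : Integrable g μ) (hfg : ∀ᵐ x ∂μ, f x < g x) :
    ∫ x, f x ∂μ < ∫ x, g x ∂μ := by
  refine (integral_mono_ae hf hg (hfg.mono fun _ hx => hx.le)).lt_of_ne fun heq => hμ ?_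
  have hae := (integral_eq_iff_of_ae_le hf hg (hfg.mono fun _ hx => hx.le)).1 heq
  have hfalse : ∀ᵐ _ ∂μ, False := by
    filter_upwards [hfg, hae] with x h1 h2 using h1.ne h2
  rwa [eventually_false_iff_eq_bot, ae_eq_bot] at hfalse

section BoundedAbove

variable {h : ℝ} {lam : Measure ℝ} [IsFiniteMeasure lam]

lemma abs_exp_mul_sub_one_le (hh : 0 < h) {x β B : ℝ} (hβ : 0 ≤ β) (hB : β ≤ B) (hx : x ≤ h) :
    ‖Real.exp (β * x) - 1‖ ≤ Real.exp (B * h) + 1 := by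
  have h1 : Real.exp (β * x) ≤ Real.exp (B * h) := Real.exp_le_exp.2 (by nlinarith)
  have h2 := Real.exp_pos (β * x)
  rw [Real.norm_eq_abs, abs_le]
  constructor <;> linarith

lemma integrable_exp_mul_sub_one_s3 (hh : 0 < h) (hle : ∀ᵐ x ∂lam, x ≤ h) {β : ℝ} (hβ : 0 ≤ β) :
    Integrable (fun x : ℝ => Real.exp (β * x) - 1) lam := by
  refine Integrable.of_bound (by fun_prop) (Real.exp (β * h) + 1) ?_
  filter_upwards [hle] with x hx using abs_exp_mul_sub_one_le hh hβ le_rfl hx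

lemma continuousOn_integral_exp_mul_sub_one (hh : 0 < h) (hle : ∀ᵐ x ∂lam, x ≤ h) :
    ContinuousOn (fun β : ℝ => ∫ x : ℝ, (Real.exp (β * x) - 1) ∂lam) (Set.Ioi 0) := by
  intro β hβ
  apply ContinuousAt.continuousWithinAt
  refine continuousAt_of_dominated (bound := fun _ => Real.exp ((β + 1) * h) + 1)
    (Eventually.of_forall fun _ => by fun_prop) ?_ (integrable_const _)
    (Eventually.of_forall fun x => by fun_prop)
  filter_upwards [Ioo_mem_nhds hβ (lt_add_one β)] with γ hγ
  filter_upwards [hle] with x hx using abs_exp_mul_sub_one_le hh hγ.1.le hγ.2.le hx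

lemma integral_exp_mul_sub_one_div_lt (hh : 0 < h) (hne : lam ≠ 0) (hle : ∀ᵐ x ∂lam, x ≤ h)
    (h0 : ∀ᵐ x ∂lam, x ≠ 0) {a b : ℝ} (ha : 0 < a) (hab : a < b) :
    ∫ x : ℝ, (Real.exp (a * x) - 1) ∂lam < a / b * ∫ x : ℝ, (Real.exp (b * x) - 1) ∂lam := by
  rw [← integral_const_mul]
  refine integral_lt_integral_of_ae_lt hne (integrable_exp_mul_sub_one_s3 hh hle ha.le)
    ((integrable_exp_mul_sub_one_s3 hh hle (ha.trans hab).le).const_mul _) ?_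
  filter_upwards [h0] with x hx using exp_mul_sub_one_lt ha hab hx

lemma exists_integral_exp_mul_sub_one_pos (hh : 0 < h) (hle : ∀ᵐ x ∂lam, x ≤ h)
    (hath : 0 < lam {h}) : ∃ β : ℝ, 0 < β ∧ 0 < ∫ x : ℝ, (Real.exp (β * x) - 1) ∂lam := by
  have hp : 0 < lam.real {h} := ENNReal.toReal_pos hath.ne' (measure_ne_top _ _)
  have hm : 0 < lam.real Set.univ := hp.trans_le (measureReal_mono (Set.subset_univ _))
  set p := lam.real {h}
  set m := lam.real Set.univ
  set β := m / p / h with hβdef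
  have hβ : 0 < β := by positivity
  refine ⟨β, hβ, ?_⟩
  have hint : Integrable (Set.indicator {h} fun _ : ℝ => Real.exp (β * h)) lam :=
    (integrable_const _).indicator (measurableSet_singleton h)
  have hlow : ∫ x : ℝ, (Set.indicator {h} (fun _ : ℝ => Real.exp (β * h)) x - 1) ∂lam
      ≤ ∫ x : ℝ, (Real.exp (β * x) - 1) ∂lam := by
    refine integral_mono (hint.sub (integrable_const _))
      (integrable_exp_mul_sub_one_s3 hh hle hβ.le) fun x => ?_
    by_cases hx : x = h
    · simp [hx]
    · simp [hx, (Real.exp_pos (β * x)).le]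
  rw [integral_sub hint (integrable_const _),
    integral_indicator_const _ (measurableSet_singleton h), integral_const] at hlow
  simp only [smul_eq_mul, mul_one] at hlow
  have hexp := Real.add_one_le_exp (β * h)
  have hβh : p * (β * h) = m := by rw [hβdef]; field_simp
  have := mul_le_mul_of_nonneg_left hexp hp.le
  change p * Real.exp (β * h) - m ≤ _ at hlow
  nlinarith

/-- If the Laplace exponent is nonnegative at all `1 / (n + 1)`, then Fatou's lemma bounds the
integral of `x ↦ C - x` with `C = e ^ h - 1`. -/
lemma lintegral_sub_le_of_integral_nonneg (hh : 0 < h) (hle : ∀ᵐ x ∂lam, x ≤ h)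
    (hnn : ∀ n : ℕ, 0 ≤ ∫ x : ℝ, (Real.exp (1 / ((n : ℝ) + 1) * x) - 1) ∂lam) :
    ∫⁻ x : ℝ, ENNReal.ofReal (Real.exp h - 1 - x) ∂lam ≤
      ENNReal.ofReal ((Real.exp h - 1) * lam.real Set.univ) := by
  set C := Real.exp h - 1 with hC
  set f : ℕ → ℝ → ℝ := fun n x => ((n : ℝ) + 1) * (Real.exp (1 / ((n : ℝ) + 1) * x) - 1) with hf
  have hlim : ∀ x : ℝ, Tendsto (fun n => f n x) atTop (𝓝 x) := by
    intro x
    have hd : HasDerivAt (fun t : ℝ => Real.exp (t * x)) x 0 := by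
      simpa using ((hasDerivAt_id (0 : ℝ)).mul_const x).exp
    have hu : Tendsto (fun n : ℕ => 1 / ((n : ℝ) + 1)) atTop (𝓝[≠] 0) :=
      tendsto_nhdsWithin_iff.2 ⟨tendsto_one_div_add_atTop_nhds_zero_nat,
        Eventually.of_forall fun n => by
          have : (0 : ℝ) < 1 / ((n : ℝ) + 1) := by positivity
          exact this.ne'⟩
    have := (hasDerivAt_iff_tendsto_slope.1 hd).comp hu
    refine this.congr fun n => ?_
    simp [slope, hf]
  have hint : ∀ n, Integrable (f n) lam := fun n =>
    (integrable_exp_mul_sub_one_s3 hh hle (by positivity)).const_mul _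
  have hfC : ∀ n, ∀ᵐ x ∂lam, 0 ≤ C - f n x := by
    intro n
    filter_upwards [hle] with x hx
    have hn : (0 : ℝ) < (n : ℝ) + 1 := by positivity
    have h1 := exp_mul_sub_one_le (a := 1 / ((n : ℝ) + 1)) (b := 1) (x := x) (by positivity)
      ((div_le_one hn).2 (by linarith [(n.cast_nonneg : (0 : ℝ) ≤ n)]))
    have h2 := mul_le_mul_of_nonneg_left h1 hn.le
    have h3 : ((n : ℝ) + 1) * (1 / ((n : ℝ) + 1) / 1 * (Real.exp (1 * x) - 1))
        = Real.exp x - 1 := by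
      rw [one_mul]; field_simp
    rw [h3] at h2
    have h4 := Real.exp_le_exp.2 hx
    simp only [hf, hC]
    linarith
  calc ∫⁻ x : ℝ, ENNReal.ofReal (C - x) ∂lam
      = ∫⁻ x : ℝ, liminf (fun n => ENNReal.ofReal (C - f n x)) atTop ∂lam := by
        refine lintegral_congr fun x => ?_
        exact ((ENNReal.tendsto_ofReal ((hlim x).const_sub C)).liminf_eq).symm
    _ ≤ liminf (fun n => ∫⁻ x : ℝ, ENNReal.ofReal (C - f n x) ∂lam) atTop :=
        lintegral_liminf_le fun n => by fun_prop
    _ ≤ liminf (fun _ : ℕ => ENNReal.ofReal (C * lam.real Set.univ)) atTop := by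
        refine liminf_le_liminf (Eventually.of_forall fun n => ?_)
        rw [← ofReal_integral_eq_lintegral_ofReal (f := fun x => C - f n x)
          ((integrable_const C).sub (hint n)) (hfC n)]
        refine ENNReal.ofReal_le_ofReal ?_
        rw [integral_sub (integrable_const C) (hint n), integral_const, smul_eq_mul]
        have : 0 ≤ ∫ x, f n x ∂lam := by
          simp only [hf]
          rw [integral_const_mul]
          exact mul_nonneg (by positivity) (hnn n)
        linarith
    _ = _ := liminf_const _

lemma exists_integral_exp_mul_sub_one_neg (hh : 0 < h) (hle : ∀ᵐ x ∂lam, x ≤ h)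
    (hmean : (Integrable (fun x : ℝ => x) lam ∧ (∫ x : ℝ, x ∂lam) < 0) ∨
      (∫⁻ x : ℝ, ENNReal.ofReal (max (-x) 0) ∂lam = ⊤)) :
    ∃ β : ℝ, 0 < β ∧ ∫ x : ℝ, (Real.exp (β * x) - 1) ∂lam < 0 := by
  by_contra! hcon
  have hfatou := lintegral_sub_le_of_integral_nonneg hh hle
    fun n => hcon (1 / ((n : ℝ) + 1)) (by positivity)
  have hhC : h ≤ Real.exp h - 1 := by linarith [Real.add_one_le_exp h]
  rcases hmean with ⟨hint, hneg⟩ | htop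
  · rw [← ofReal_integral_eq_lintegral_ofReal (f := fun x => Real.exp h - 1 - x)
      ((integrable_const _).sub hint)
      (by filter_upwards [hle] with x hx; exact sub_nonneg.2 (hx.trans hhC)),
      ENNReal.ofReal_le_ofReal_iff (mul_nonneg (by linarith) measureReal_nonneg),
      integral_sub (integrable_const _) hint, integral_const, smul_eq_mul] at hfatou
    linarith
  · refine absurd (htop ▸ (lintegral_mono_ae ?_).trans hfatou) (by simp)
    filter_upwards [hle] with x hx
    exact ENNReal.ofReal_le_ofReal (max_le (by linarith) (by linarith))

end BoundedAbove

/-- Classification of the zeros of the Laplace exponent `ψ` on `[0,∞)`: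
`ψ(0) = 0`; if `x ↦ x` is `λ`-integrable with nonnegative mean then `0` is the only zero;
if the mean is negative (or `∫ max(−x,0) λ(dx) = +∞`) then there is exactly one further zero
`Φ₀ ∈ (0,∞)` and the zero set is `{0, Φ₀}`. -/
theorem stmt3 (h : ℝ) (hh : 0 < h) (lam : Measure ℝ) [IsFiniteMeasure lam] (hne : lam ≠ 0)
    (hzero : lam {0} = 0)
    (hsupp : lam {x : ℝ | ∀ k : ℤ, x ≠ k * h} = 0)
    (hIoi : lam (Set.Ioi (0 : ℝ)) = lam {h}) (hath : 0 < lam {h}) :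
    (∫ x : ℝ, (Real.exp ((0 : ℝ) * x) - 1) ∂lam) = 0 ∧
    ((Integrable (fun x : ℝ => x) lam ∧ 0 ≤ ∫ x : ℝ, x ∂lam) →
      {β : ℝ | 0 ≤ β ∧ (∫ x : ℝ, (Real.exp (β * x) - 1) ∂lam) = 0} = {0}) ∧
    (((Integrable (fun x : ℝ => x) lam ∧ (∫ x : ℝ, x ∂lam) < 0) ∨
        (∫⁻ x : ℝ, ENNReal.ofReal (max (-x) 0) ∂lam = ⊤)) →
      ∃ Φ₀ : ℝ, 0 < Φ₀ ∧
        {β : ℝ | 0 ≤ β ∧ (∫ x : ℝ, (Real.exp (β * x) - 1) ∂lam) = 0} = {0, Φ₀}) := by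
  have hle : ∀ᵐ x ∂lam, x ≤ h := by
    have hdiff : lam (Set.Ioi 0 \ {h}) = 0 := by
      rw [measure_sdiff (Set.singleton_subset_iff.2 (Set.mem_Ioi.2 hh))
        (measurableSet_singleton h).nullMeasurableSet (measure_ne_top _ _), hIoi, tsub_self]
    refine measure_mono_null (fun x hx => ?_) hdiff
    have hx' : h < x := not_le.1 hx
    exact ⟨hh.trans hx', hx'.ne'⟩
  have h0 : ∀ᵐ x ∂lam, x ≠ 0 := measure_mono_null (fun x hx => by simpa using hx) hzero
  refine ⟨by simp, ?_, ?_⟩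
  · rintro ⟨hint, hmean⟩
    ext β
    simp only [Set.mem_ofPred_eq, Set.mem_singleton_iff]
    refine ⟨fun ⟨hβ, hz⟩ => ?_, by rintro rfl; simp⟩
    by_contra hβ0
    have hpos : 0 < β := lt_of_le_of_ne hβ (Ne.symm hβ0)
    have hlt := integral_lt_integral_of_ae_lt hne (hint.const_mul β)
      (integrable_exp_mul_sub_one_s3 hh hle hβ) (by
        filter_upwards [h0] with x hx
        linarith [Real.add_one_lt_exp (mul_ne_zero hβ0 hx)])
    rw [hz, integral_const_mul] at hlt
    exact hlt.not_ge (mul_nonneg hβ hmean)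
  · intro hmean
    obtain ⟨a, ha, hna⟩ := exists_integral_exp_mul_sub_one_neg hh hle hmean
    obtain ⟨b, hb, hpb⟩ := exists_integral_exp_mul_sub_one_pos hh hle hath
    obtain ⟨c, hc, hzc⟩ := isPreconnected_Ioi.intermediate_value (Set.mem_Ioi.2 ha)
      (Set.mem_Ioi.2 hb) (continuousOn_integral_exp_mul_sub_one hh hle)
      (Set.mem_Icc.2 ⟨hna.le, hpb.le⟩)
    refine ⟨c, hc, ?_⟩
    ext β
    simp only [Set.mem_ofPred_eq, Set.mem_insert_iff, Set.mem_singleton_iff]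
    constructor
    · rintro ⟨hβ, hz⟩
      refine hβ.eq_or_lt.imp Eq.symm fun hpos => ?_
      rcases lt_trichotomy β c with hlt | heq | hgt
      · have := integral_exp_mul_sub_one_div_lt hh hne hle h0 hpos hlt
        simp [hz, hzc] at this
      · exact heq
      · have := integral_exp_mul_sub_one_div_lt hh hne hle h0 hc hgt
        simp [hz, hzc] at this
    · rintro (rfl | rfl)
      · simp
      · exact ⟨le_of_lt hc, hzc⟩
end

section
/- Assume additionally that x ↦ x is λ-integrable with ∫ x λ(dx) = 0. Then lim_{β↓0} ψ(β)/β² = (1/2)∫ x² λ(dx) in the extended sense: if ∫ x² λ(dx) < ∞ then ψ(β)/β² → (∫ x² λ(dx))/2 as β ↓ 0, while if ∫ x² λ(dx) = +∞ then ψ(β)/β² → +∞ as β ↓ 0. -/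
open MeasureTheory Filter

open Topology

lemma exp_sub_one_sub_id_nonneg (y : ℝ) : 0 ≤ Real.exp y - 1 - y := by
  linarith [Real.add_one_le_exp y]

lemma exp_sub_one_sub_id_le_sq {y : ℝ} (hy : y ≤ 1) : Real.exp y - 1 - y ≤ y ^ 2 := by
  rcases le_total (-1) y with h | h
  · exact (le_abs_self _).trans (Real.abs_exp_sub_one_sub_id_le (abs_le.mpr ⟨h, hy⟩))
  · have := Real.exp_le_one_iff.mpr (h.trans (by norm_num))
    nlinarith

lemma tendsto_exp_mul_sub_one_sub_div_sq (x : ℝ) :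
    Tendsto (fun β : ℝ => (Real.exp (β * x) - 1 - β * x) / β ^ 2) (𝓝[>] 0) (𝓝 (x ^ 2 / 2)) := by
  have hmul : Tendsto (fun β : ℝ => β * x) (𝓝[>] 0) (𝓝 0) := by
    have : Tendsto (fun β : ℝ => β * x) (𝓝 0) (𝓝 (0 * x)) := by
      exact (continuous_id.mul continuous_const).tendsto 0
    rw [zero_mul] at this
    exact this.mono_left nhdsWithin_le_nhds
  have hlim := (((Real.exp_sub_sum_range_succ_isLittleO_pow 2).tendsto_div_nhds_zero.comp
    hmul).const_mul (x ^ 2)).add_const (x ^ 2 / 2)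
  rw [mul_zero, zero_add] at hlim
  refine hlim.congr' ?_
  filter_upwards [self_mem_nhdsWithin] with β (hβ : 0 < β)
  rcases eq_or_ne x 0 with rfl | hx
  · simp
  · have := hβ.ne'
    simp only [Function.comp_apply, Finset.sum_range_succ, Finset.sum_range_zero, Nat.factorial]
    field_simp
    push_cast
    ring

/-- Subtracting the vanishing first moment from the exponent does not change the integral. -/
lemma integral_exp_mul_sub_one_div_sq {μ : Measure ℝ} [IsFiniteMeasure μ] {h : ℝ}
    (hle : ∀ᵐ x ∂μ, x ≤ h) (hint : Integrable (fun x : ℝ => x) μ) (hmean : ∫ x, x ∂μ = 0)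
    {β : ℝ} (hβ : 0 < β) :
    Integrable (fun x => (Real.exp (β * x) - 1 - β * x) / β ^ 2) μ ∧
      ∫ x, (Real.exp (β * x) - 1 - β * x) / β ^ 2 ∂μ =
        (∫ x, (Real.exp (β * x) - 1) ∂μ) / β ^ 2 := by
  have hexp : Integrable (fun x => Real.exp (β * x)) μ := by
    refine Integrable.of_bound (by fun_prop) (Real.exp (β * h)) ?_
    filter_upwards [hle] with x hx
    rw [Real.norm_eq_abs, Real.abs_exp]
    gcongr
  have hexp1 : Integrable (fun x => Real.exp (β * x) - 1) μ := hexp.sub (integrable_const 1)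
  refine ⟨(hexp1.sub (hint.const_mul β)).div_const _, ?_⟩
  rw [integral_div, integral_sub hexp1 (hint.const_mul β), integral_const_mul, hmean]
  simp

/-- If `x ↦ x` is `λ`-integrable with `∫ x λ(dx) = 0`, then
`lim_{β↓0} ψ(β)/β² = (1/2) ∫ x² λ(dx)` in the extended sense: the limit is
`(∫ x² λ(dx))/2` when the second moment is finite, and `+∞` otherwise. -/
theorem stmt5 (h : ℝ) (hh : 0 < h) (lam : Measure ℝ) [IsFiniteMeasure lam] (hne : lam ≠ 0)
    (hzero : lam {0} = 0)
    (hsupp : lam {x : ℝ | ∀ k : ℤ, x ≠ k * h} = 0)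
    (hIoi : lam (Set.Ioi (0 : ℝ)) = lam {h}) (hath : 0 < lam {h})
    (hint : Integrable (fun x : ℝ => x) lam) (hmean : (∫ x : ℝ, x ∂lam) = 0) :
    (Integrable (fun x : ℝ => x ^ 2) lam →
      Tendsto (fun β : ℝ => (∫ x : ℝ, (Real.exp (β * x) - 1) ∂lam) / β ^ 2)
        (nhdsWithin 0 (Set.Ioi 0)) (nhds ((∫ x : ℝ, x ^ 2 ∂lam) / 2))) ∧
    ((∫⁻ x : ℝ, ENNReal.ofReal (x ^ 2) ∂lam = ⊤) →
      Tendsto (fun β : ℝ => (∫ x : ℝ, (Real.exp (β * x) - 1) ∂lam) / β ^ 2)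
        (nhdsWithin 0 (Set.Ioi 0)) atTop) := by
  have hle : ∀ᵐ x ∂lam, x ≤ h := by
    have hsub : lam (Set.Ioi 0 \ {h}) = 0 := by
      rw [measure_sdiff (by simpa using hh) (measurableSet_singleton h).nullMeasurableSet
        (measure_ne_top _ _), hIoi, tsub_self]
    rw [ae_iff]
    refine measure_mono_null (fun x hx => ?_) hsub
    have hx : h < x := not_le.mp hx
    exact ⟨hh.trans hx, hx.ne'⟩
  have heq : (fun β : ℝ => ∫ x, (Real.exp (β * x) - 1 - β * x) / β ^ 2 ∂lam) =ᶠ[𝓝[>] 0]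
      fun β : ℝ => (∫ x : ℝ, (Real.exp (β * x) - 1) ∂lam) / β ^ 2 := by
    filter_upwards [self_mem_nhdsWithin] with β hβ
    exact (integral_exp_mul_sub_one_div_sq hle hint hmean hβ).2
  constructor
  · intro hsq
    refine Tendsto.congr' heq ?_
    rw [← integral_div]
    refine tendsto_integral_filter_of_dominated_convergence (fun x => x ^ 2)
      (Eventually.of_forall fun β => by fun_prop) ?_ hsq
      (Eventually.of_forall tendsto_exp_mul_sub_one_sub_div_sq)
    filter_upwards [Ioo_mem_nhdsGT (inv_pos.mpr hh)] with β hβ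
    filter_upwards [hle] with x hx
    have hβx : β * x ≤ 1 := by
      calc β * x ≤ β * h := by have := hβ.1; gcongr
        _ ≤ h⁻¹ * h := by have := hβ.2; gcongr
        _ = 1 := inv_mul_cancel₀ hh.ne'
    rw [Real.norm_of_nonneg (div_nonneg (exp_sub_one_sub_id_nonneg _) (sq_nonneg _)),
      div_le_iff₀ (pow_pos hβ.1 2), ← mul_pow, mul_comm x β]
    exact exp_sub_one_sub_id_le_sq hβx
  · intro htop
    refine Tendsto.congr' heq (ENNReal.tendsto_ofReal_nhds_top.mp ?_)
    have hlint : (fun β : ℝ =>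
          ∫⁻ x, ENNReal.ofReal ((Real.exp (β * x) - 1 - β * x) / β ^ 2) ∂lam) =ᶠ[𝓝[>] 0]
        fun β : ℝ => ENNReal.ofReal (∫ x, (Real.exp (β * x) - 1 - β * x) / β ^ 2 ∂lam) := by
      filter_upwards [self_mem_nhdsWithin] with β hβ
      exact (ofReal_integral_eq_lintegral_ofReal
        (integral_exp_mul_sub_one_div_sq hle hint hmean hβ).1 (Eventually.of_forall fun x =>
          div_nonneg (exp_sub_one_sub_id_nonneg _) (sq_nonneg _))).symm
    refine Tendsto.congr' hlint (tendsto_of_seq_tendsto fun u hu => ?_)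
    have hhalf : ∫⁻ x, ENNReal.ofReal (x ^ 2 / 2) ∂lam = ⊤ := by
      have : ∀ x : ℝ, ENNReal.ofReal (x ^ 2 / 2) =
          ENNReal.ofReal (x ^ 2) * ENNReal.ofReal (1 / 2) := fun x => by
        rw [← ENNReal.ofReal_mul (sq_nonneg x)]
        ring_nf
      simp_rw [this]
      rw [lintegral_mul_const _ (by fun_prop), htop, ENNReal.top_mul (by simp)]
    refine tendsto_of_le_liminf_of_limsup_le ?_ le_top
    calc (⊤ : ENNReal) = ∫⁻ x, liminf (fun n => ENNReal.ofReal
          ((Real.exp (u n * x) - 1 - u n * x) / u n ^ 2)) atTop ∂lam := by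
          rw [← hhalf]
          refine lintegral_congr fun x => ?_
          exact ((ENNReal.tendsto_ofReal
            (tendsto_exp_mul_sub_one_sub_div_sq x)).comp hu).liminf_eq.symm
      _ ≤ _ := lintegral_liminf_le fun n => by fun_prop
end

section
/- For every β ≥ 0 one has ψ(β) = φ(β)·(e^{βh} − x). (This is the functional equation linking the Laplace exponent of the parent upwards skip-free Lévy chain to the Laplace exponent of its descending ladder heights process.) -/
open MeasureTheory

/-- Summation by parts behind the functional equation: if `E * r 0 = 1` and
`E * r (k + 1) = r k`, the series with coefficients `x * a k - a (k + 1)` is expressed through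
`∑ a k` and `∑ a k * r k`. -/
lemma hasSum_sub_shift_mul {a r : ℕ → ℝ} {S R E : ℝ} (x : ℝ) (ha : HasSum a S)
    (har : HasSum (fun k => a k * r k) R) (h0 : E * r 0 = 1)
    (hr : ∀ k, E * r (k + 1) = r k) :
    HasSum (fun k => (x * a k - a (k + 1)) * (r k - 1)) ((S - R) * (E - x) + S * (1 - E)) := by
  have ha' : HasSum (fun k => a (k + 1)) (S - a 0) := by
    simpa using (hasSum_nat_add_iff' 1).mpr ha
  have har' : HasSum (fun k => a (k + 1) * r (k + 1)) (R - a 0 * r 0) := by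
    simpa using (hasSum_nat_add_iff' 1).mpr har
  convert! (((har.sub ha).mul_left x).sub (har'.mul_left E)).add ha' using 1
  · ext k
    linear_combination a (k + 1) * hr k
  · linear_combination -a 0 * h0

/-- For the parent upwards skip-free Lévy chain built from the data `(q, γ, (φ_k)_{k≥1}, x)`,
the Laplace exponent `ψ` and the Laplace exponent `φ` of the descending ladder heights process
satisfy `ψ(β) = φ(β)·(e^{βh} − x)` for every `β ≥ 0`.  Here `φ (k+1)` plays the role of `φ_k`
(`k ≥ 1`). -/
theorem stmt6 (h q γ : ℝ) (hh : 0 < h) (hq : 0 ≤ q) (hγ : 0 ≤ γ) (hγq : γ * q = 0)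
    (φ : ℕ → ℝ) (hφ : ∀ k : ℕ, 0 ≤ φ (k + 1))
    (hsummable : Summable (fun k : ℕ => φ (k + 1)))
    (hpos : 0 < q + ∑' k : ℕ, φ (k + 1))
    (x : ℝ) (hx1 : 1 ≤ x)
    (hxγ0 : γ = 0 → x = 1)
    (hxγ : 0 < γ → 1 < x ∧ γ = (1 - 1 / x) * (φ 1 + x * ∑' k : ℕ, φ (k + 1)))
    (hlamneg : ∀ k : ℕ, 0 ≤ x * φ (k + 1) - φ (k + 2))
    (lam : Measure ℝ)
    (hlam : lam = ENNReal.ofReal (q + ∑' k : ℕ, φ (k + 1)) • Measure.dirac h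
      + Measure.sum (fun k : ℕ =>
          ENNReal.ofReal (x * φ (k + 1) - φ (k + 2)) • Measure.dirac (-((k : ℝ) + 1) * h))) :
    ∀ β : ℝ, 0 ≤ β →
      (∫ y : ℝ, (Real.exp (β * y) - 1) ∂lam)
        = (q + ∑' k : ℕ, φ (k + 1) * (1 - Real.exp (-β * ((k : ℝ) + 1) * h)))
          * (Real.exp (β * h) - x) := by
  intro β hβ
  have hφr : Summable fun k : ℕ => φ (k + 1) * Real.exp (-β * ((k : ℝ) + 1) * h) := by
    refine hsummable.of_nonneg_of_le (fun k => mul_nonneg (hφ k) (Real.exp_pos _).le) fun k => ?_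
    refine mul_le_of_le_one_right (hφ k) (Real.exp_le_one_iff.mpr ?_)
    have : 0 ≤ β * ((k : ℝ) + 1) * h := by positivity
    linarith
  have hsum := hasSum_sub_shift_mul x hsummable.hasSum hφr.hasSum
    (r := fun k : ℕ => Real.exp (-β * ((k : ℝ) + 1) * h)) (E := Real.exp (β * h))
    (by rw [← Real.exp_add, Real.exp_eq_one_iff]; push_cast; ring)
    (fun k => by rw [← Real.exp_add]; push_cast; ring_nf)
  have hφsum : ∑' k : ℕ, φ (k + 1) * (1 - Real.exp (-β * ((k : ℝ) + 1) * h))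
      = ∑' k : ℕ, φ (k + 1) - ∑' k : ℕ, φ (k + 1) * Real.exp (-β * ((k : ℝ) + 1) * h) := by
    rw [← hsummable.tsum_sub hφr]
    exact tsum_congr fun k => by ring
  have hqx : q * x = q := by
    rcases mul_eq_zero.mp hγq with h0 | h0
    · rw [hxγ0 h0, mul_one]
    · rw [h0, zero_mul]
  have hterm : ∀ k : ℕ, (ENNReal.ofReal (x * φ (k + 1) - φ (k + 2))).toReal
        * (Real.exp (β * (-((k : ℝ) + 1) * h)) - 1)
      = (x * φ (k + 1) - φ (k + 1 + 1)) * (Real.exp (-β * ((k : ℝ) + 1) * h) - 1) := by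
    intro k
    rw [ENNReal.toReal_ofReal (hlamneg k)]
    ring_nf
  have hnorm : Summable fun k : ℕ => (ENNReal.ofReal (x * φ (k + 1) - φ (k + 2))).toReal
      * ‖Real.exp (β * (-((k : ℝ) + 1) * h)) - 1‖ := by
    refine (hsum.summable.congr fun k => (hterm k).symm).norm.congr fun k => ?_
    rw [norm_mul, Real.norm_of_nonneg ENNReal.toReal_nonneg]
  have hc : ∀ k : ℕ, ENNReal.ofReal (x * φ (k + 1) - φ (k + 2)) ≠ ⊤ :=
    fun _ => ENNReal.ofReal_ne_top
  have hint := integrable_sum_dirac (f := fun y : ℝ => Real.exp (β * y) - 1) hc hnorm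
  have htsum := hasSum_integral_sum_dirac (f := fun y : ℝ => Real.exp (β * y) - 1) hc hnorm
  simp only [smul_eq_mul, hterm] at htsum
  rw [hlam, integral_add_measure
    ((integrable_dirac (by simp)).smul_measure ENNReal.ofReal_ne_top) hint,
    integral_smul_measure, integral_dirac, ENNReal.toReal_ofReal hpos.le, smul_eq_mul,
    htsum.unique hsum, hφsum]
  linear_combination hqx
end

section
/- (i) ψ((log x)/h) = 0 and ψ(β) > 0 for every β > (log x)/h; in other words, (log x)/h is the largest zero of ψ on [0,∞) (so x = e^{Φ(0)h} for the parent process). (ii) If γ = 0 (so x = 1), then y ↦ y is λ-integrable and ∫ y λ(dy) = h·q ≥ 0. -/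
open MeasureTheory
open Filter Topology

lemma integrable_and_integral_smul_dirac_add_sum {c p : ℝ} {d y : ℕ → ℝ} {f : ℝ → ℝ}
    (hc : 0 ≤ c) (hd : ∀ k, 0 ≤ d k) (hf : Summable fun k => d k * |f (y k)|) :
    Integrable f (ENNReal.ofReal c • Measure.dirac p
      + Measure.sum fun k => ENNReal.ofReal (d k) • Measure.dirac (y k)) ∧
    ∫ t, f t ∂(ENNReal.ofReal c • Measure.dirac p
      + Measure.sum fun k => ENNReal.ofReal (d k) • Measure.dirac (y k))
      = c * f p + ∑' k, d k * f (y k) := by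
  have hi : Integrable f (ENNReal.ofReal c • Measure.dirac p) :=
    (integrable_dirac (by simp)).smul_measure ENNReal.ofReal_ne_top
  have hs : Integrable f (Measure.sum fun k => ENNReal.ofReal (d k) • Measure.dirac (y k)) :=
    integrable_sum_dirac (fun _ => ENNReal.ofReal_ne_top)
      (by simpa [ENNReal.toReal_ofReal, hd] using hf)
  refine ⟨hi.add_measure hs, ?_⟩
  rw [integral_add_measure hi hs, integral_sum_dirac fun _ => ENNReal.ofReal_ne_top]
  simp [ENNReal.toReal_ofReal, hc, hd]

/-- Abel summation for a summable, nonnegative, nonincreasing sequence. -/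
lemma hasSum_succ_mul_sub_of_antitone {a : ℕ → ℝ} (ha : ∀ k, 0 ≤ a k) (hs : Summable a)
    (hmono : ∀ k, a (k + 1) ≤ a k) :
    HasSum (fun k : ℕ => ((k : ℝ) + 1) * (a k - a (k + 1))) (∑' k, a k) := by
  have hnn : ∀ k : ℕ, 0 ≤ ((k : ℝ) + 1) * (a k - a (k + 1)) := fun k =>
    mul_nonneg (by positivity) (sub_nonneg.2 (hmono k))
  have hpart : ∀ n : ℕ, ∑ k ∈ Finset.range n, ((k : ℝ) + 1) * (a k - a (k + 1))
      = ∑ k ∈ Finset.range n, a k - n * a n := by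
    intro n
    induction n with
    | zero => simp
    | succ n ih =>
      rw [Finset.sum_range_succ, Finset.sum_range_succ, ih]
      push_cast
      ring
  have hsum : Summable fun k : ℕ => ((k : ℝ) + 1) * (a k - a (k + 1)) := by
    refine summable_of_sum_range_le hnn (c := ∑' k, a k) fun n => ?_
    rw [hpart]
    have h1 := hs.sum_le_tsum (Finset.range n) fun k _ => ha k
    have h2 : 0 ≤ (n : ℝ) * a n := mul_nonneg (by positivity) (ha n)
    linarith
  have htail : ∀ n : ℕ, (n : ℝ) * a n
      ≤ ∑' k : ℕ, (((k + n : ℕ) : ℝ) + 1) * (a (k + n) - a (k + n + 1)) := by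
    intro n
    have htele : HasSum (fun k : ℕ => a (k + n) - a (k + n + 1)) (a n) := by
      rw [hasSum_iff_tendsto_nat_of_nonneg fun k => sub_nonneg.2 (hmono (k + n))]
      have hlim : Tendsto (fun m => a n - a (m + n)) atTop (𝓝 (a n - 0)) :=
        tendsto_const_nhds.sub ((tendsto_add_atTop_iff_nat n).2 hs.tendsto_atTop_zero)
      rw [sub_zero] at hlim
      refine hlim.congr fun m => ?_
      have := Finset.sum_range_sub' (fun k => a (k + n)) m
      simp only [zero_add] at this
      rw [← this]
      refine Finset.sum_congr rfl fun k _ => ?_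
      rw [add_right_comm]
    refine hasSum_le (fun k => ?_) (htele.mul_left (n : ℝ))
      ((summable_nat_add_iff n).2 hsum).hasSum
    refine mul_le_mul_of_nonneg_right ?_ (sub_nonneg.2 (hmono (k + n)))
    push_cast
    linarith [(Nat.cast_nonneg k : (0 : ℝ) ≤ k)]
  have hzero : Tendsto (fun n : ℕ => (n : ℝ) * a n) atTop (𝓝 0) :=
    squeeze_zero (fun n => mul_nonneg (by positivity) (ha n)) htail
      (tendsto_sum_nat_add fun k : ℕ => ((k : ℝ) + 1) * (a k - a (k + 1)))
  rw [hasSum_iff_tendsto_nat_of_nonneg hnn]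
  simpa [hpart] using hs.hasSum.tendsto_sum_nat.sub hzero

/-- Rearranged form of the negative-jump part of the Laplace exponent, with `w = e^{βh}`. -/
lemma tsum_mul_sub_mul_inv_pow_sub_one {a : ℕ → ℝ} (ha : ∀ k, 0 ≤ a k) (hs : Summable a)
    (x : ℝ) {w : ℝ} (hw : 1 ≤ w) :
    (Summable fun k => (x * a k - a (k + 1)) * (w⁻¹ ^ (k + 1) - 1)) ∧
    (Summable fun k => a k * (1 - w⁻¹ ^ (k + 1))) ∧
    ∑' k, (x * a k - a (k + 1)) * (w⁻¹ ^ (k + 1) - 1)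
      = (w - x) * ∑' k, a k * (1 - w⁻¹ ^ (k + 1)) - (w - 1) * ∑' k, a k := by
  have hw0 : 0 < w := by linarith
  have hz0 : 0 ≤ w⁻¹ := by positivity
  have hz1 : w⁻¹ ≤ 1 := inv_le_one_of_one_le₀ hw
  have hB : Summable fun k => a k * (1 - w⁻¹ ^ (k + 1)) := by
    refine Summable.of_nonneg_of_le (fun k => ?_) (fun k => ?_) hs
    · exact mul_nonneg (ha k) (sub_nonneg.2 (pow_le_one₀ hz0 hz1))
    · exact mul_le_of_le_one_right (ha k) (by linarith [pow_nonneg hz0 (k + 1)])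
  have hs1 := (summable_nat_add_iff 1).2 hs
  have hB1 := (summable_nat_add_iff 1).2 hB
  have key : HasSum (fun k => -x * (a k * (1 - w⁻¹ ^ (k + 1)))
      + (w * (a (k + 1) * (1 - w⁻¹ ^ (k + 1 + 1))) - (w - 1) * a (k + 1)))
      (-x * ∑' k, a k * (1 - w⁻¹ ^ (k + 1))
      + (w * ∑' k, a (k + 1) * (1 - w⁻¹ ^ (k + 1 + 1)) - (w - 1) * ∑' k, a (k + 1))) :=
    (hB.hasSum.mul_left _).add ((hB1.hasSum.mul_left _).sub (hs1.hasSum.mul_left _))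
  have heq : (fun k => (x * a k - a (k + 1)) * (w⁻¹ ^ (k + 1) - 1))
      = fun k => -x * (a k * (1 - w⁻¹ ^ (k + 1)))
      + (w * (a (k + 1) * (1 - w⁻¹ ^ (k + 1 + 1))) - (w - 1) * a (k + 1)) := by
    funext k
    have : w * w⁻¹ ^ (k + 1 + 1) = w⁻¹ ^ (k + 1) := by
      rw [pow_succ, mul_comm, mul_assoc, inv_mul_cancel₀ hw0.ne', mul_one]
    linear_combination a (k + 1) * this
  rw [heq]
  refine ⟨key.summable, hB, ?_⟩
  rw [key.tsum_eq, hs.tsum_eq_zero_add, hB.tsum_eq_zero_add]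
  have : w * w⁻¹ = 1 := mul_inv_cancel₀ hw0.ne'
  linear_combination (a 0) * this

/-- (i) `(log x)/h` is the largest zero of the Laplace exponent `ψ` of the parent process
(so `x = e^{Φ(0)h}`); (ii) if `γ = 0` (so `x = 1`), then `y ↦ y` is `λ`-integrable and
`∫ y λ(dy) = h·q ≥ 0`. -/
theorem stmt7 (h q γ : ℝ) (hh : 0 < h) (hq : 0 ≤ q) (hγ : 0 ≤ γ) (hγq : γ * q = 0)
    (φ : ℕ → ℝ) (hφ : ∀ k : ℕ, 0 ≤ φ (k + 1))
    (hsummable : Summable (fun k : ℕ => φ (k + 1)))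
    (hpos : 0 < q + ∑' k : ℕ, φ (k + 1))
    (x : ℝ) (hx1 : 1 ≤ x)
    (hxγ0 : γ = 0 → x = 1)
    (hxγ : 0 < γ → 1 < x ∧ γ = (1 - 1 / x) * (φ 1 + x * ∑' k : ℕ, φ (k + 1)))
    (hlamneg : ∀ k : ℕ, 0 ≤ x * φ (k + 1) - φ (k + 2))
    (lam : Measure ℝ)
    (hlam : lam = ENNReal.ofReal (q + ∑' k : ℕ, φ (k + 1)) • Measure.dirac h
      + Measure.sum (fun k : ℕ =>
          ENNReal.ofReal (x * φ (k + 1) - φ (k + 2)) • Measure.dirac (-((k : ℝ) + 1) * h))) :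
    ((∫ y : ℝ, (Real.exp ((Real.log x / h) * y) - 1) ∂lam) = 0 ∧
      ∀ β : ℝ, Real.log x / h < β → 0 < ∫ y : ℝ, (Real.exp (β * y) - 1) ∂lam) ∧
    (γ = 0 → Integrable (fun y : ℝ => y) lam ∧ (∫ y : ℝ, y ∂lam) = h * q) := by
  set S := ∑' k : ℕ, φ (k + 1)
  have hx0 : 0 < x := by linarith
  have hlog : 0 ≤ Real.log x / h := div_nonneg (Real.log_nonneg hx1) hh.le
  have hψ : ∀ β : ℝ, 0 ≤ β → ∫ y : ℝ, (Real.exp (β * y) - 1) ∂lam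
      = q * (Real.exp (β * h) - 1) + (Real.exp (β * h) - x)
        * ∑' k : ℕ, φ (k + 1) * (1 - (Real.exp (β * h))⁻¹ ^ (k + 1)) := by
    intro β hβ
    have hw : 1 ≤ Real.exp (β * h) := Real.one_le_exp (mul_nonneg hβ hh.le)
    obtain ⟨hsum, -, htsum⟩ := tsum_mul_sub_mul_inv_pow_sub_one hφ hsummable x hw
    have hexp : ∀ k : ℕ, Real.exp (β * (-((k : ℝ) + 1) * h)) - 1
        = (Real.exp (β * h))⁻¹ ^ (k + 1) - 1 := by
      intro k
      rw [← Real.exp_neg, ← Real.exp_nat_mul]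
      push_cast
      ring_nf
    rw [hlam, (integrable_and_integral_smul_dirac_add_sum hpos.le hlamneg ?_).2]
    · simp only [hexp, htsum]
      ring
    · simp only [hexp]
      refine hsum.abs.congr fun k => ?_
      rw [abs_mul, abs_of_nonneg (hlamneg k)]
  refine ⟨⟨?_, fun β hβ => ?_⟩, fun hγ0 => ?_⟩
  · rw [hψ _ hlog, div_mul_cancel₀ _ hh.ne', Real.exp_log hx0, sub_self, zero_mul, add_zero]
    rcases mul_eq_zero.1 hγq with h0 | h0
    · rw [hxγ0 h0, sub_self, mul_zero]
    · rw [h0, zero_mul]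
  · have hxw : x < Real.exp (β * h) := by
      rw [← Real.log_lt_iff_lt_exp hx0]
      exact (div_lt_iff₀ hh).1 hβ
    rw [hψ β (hlog.trans hβ.le)]
    set w := Real.exp (β * h)
    have hw : 1 < w := hx1.trans_lt hxw
    have hz1 : w⁻¹ < 1 := inv_lt_one_of_one_lt₀ hw
    have hz0 : 0 ≤ w⁻¹ := by positivity
    have hS0 : 0 ≤ S := tsum_nonneg hφ
    have hle : S * (1 - w⁻¹) ≤ ∑' k : ℕ, φ (k + 1) * (1 - w⁻¹ ^ (k + 1)) := by
      refine hasSum_le (fun k => ?_) (hsummable.hasSum.mul_right (1 - w⁻¹))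
        (tsum_mul_sub_mul_inv_pow_sub_one hφ hsummable x hw.le).2.1.hasSum
      exact mul_le_mul_of_nonneg_left
        (sub_le_sub_left (pow_le_of_le_one hz0 hz1.le k.succ_ne_zero) _) (hφ k)
    have hmul := mul_le_mul_of_nonneg_left hle (sub_nonneg.2 hxw.le)
    refine lt_of_lt_of_le ?_ (add_le_add_right hmul _)
    rcases hq.eq_or_lt with h0 | h0
    · rw [← h0, zero_add] at hpos
      rw [← h0, zero_mul, zero_add]
      exact mul_pos (sub_pos.2 hxw) (mul_pos hpos (sub_pos.2 hz1))
    · exact add_pos_of_pos_of_nonneg (mul_pos h0 (sub_pos.2 hw))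
        (mul_nonneg (sub_pos.2 hxw).le (mul_nonneg hS0 (sub_pos.2 hz1).le))
  · have hx : x = 1 := hxγ0 hγ0
    have hA : HasSum (fun k : ℕ => ((k : ℝ) + 1) * (φ (k + 1) - φ (k + 2))) S :=
      hasSum_succ_mul_sub_of_antitone hφ hsummable fun k => by
        have := hlamneg k
        rw [hx, one_mul] at this
        exact sub_nonneg.1 this
    have hsum : HasSum (fun k : ℕ => (x * φ (k + 1) - φ (k + 2)) * (-((k : ℝ) + 1) * h))
        (-h * S) := by
      refine (hA.mul_left (-h)).congr_fun fun k => ?_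
      rw [hx]
      ring
    have hint := integrable_and_integral_smul_dirac_add_sum (p := h)
      (y := fun k : ℕ => -((k : ℝ) + 1) * h) (f := fun y => y) hpos.le hlamneg
      (hsum.summable.abs.congr fun k => by rw [abs_mul, abs_of_nonneg (hlamneg k)])
    rw [hlam]
    refine ⟨hint.1, hint.2.trans ?_⟩
    rw [hsum.tsum_eq]
    ring
end

section
/- The identity ψ(β) = φ(β)·(e^{βh} − x) holds for all β ≥ 0 if and only if all three of the following hold: (1) q + Σ_{k≥1} φ_k = λ({h}); (2) x·(q + Σ_{k≥1} φ_k) + φ_1 = λ(ℝ); (3) x·φ_k − φ_{k+1} = λ({−kh}) for every k ≥ 1. -/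
open MeasureTheory

/-- A power series with absolutely summable coefficients that vanishes on `(0, 1]` has zero
constant coefficient. -/
theorem coeff_zero_eq_zero_of_tsum_mul_pow_eq_zero {c : ℕ → ℝ} (hc : Summable fun n => |c n|)
    (h : ∀ z : ℝ, 0 < z → z ≤ 1 → ∑' n, c n * z ^ n = 0) : c 0 = 0 := by
  have hIoc : ∀ᶠ z : ℝ in nhdsWithin 0 (Set.Ioi 0), z ∈ Set.Ioc (0 : ℝ) 1 :=
    Ioc_mem_nhdsGT one_pos
  have hlim : Filter.Tendsto (fun z : ℝ => ∑' n, c n * z ^ n) (nhdsWithin 0 (Set.Ioi 0))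
      (nhds (∑' n, c n * (0 : ℝ) ^ n)) := by
    refine tendsto_tsum_of_dominated_convergence hc (fun n => ?_) ?_
    · have hcont : Continuous fun z : ℝ => c n * z ^ n := by fun_prop
      exact (hcont.tendsto 0).mono_left nhdsWithin_le_nhds
    · filter_upwards [hIoc] with z hz n
      rw [norm_mul, norm_pow, Real.norm_eq_abs, Real.norm_eq_abs, abs_of_pos hz.1]
      exact mul_le_of_le_one_right (abs_nonneg _) (pow_le_one₀ hz.1.le hz.2)
  have hzero : ∑' n, c n * (0 : ℝ) ^ n = c 0 := by
    rw [tsum_eq_single 0 fun n hn => by simp [hn]]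
    simp
  rw [hzero] at hlim
  refine tendsto_nhds_unique hlim (tendsto_const_nhds.congr' ?_)
  filter_upwards [hIoc] with z hz
  exact (h z hz.1 hz.2).symm

/-- A power series with absolutely summable coefficients that vanishes on `(0, 1]` is zero. -/
theorem coeff_eq_zero_of_tsum_mul_pow_eq_zero (n : ℕ) {c : ℕ → ℝ} (hc : Summable fun n => |c n|)
    (h : ∀ z : ℝ, 0 < z → z ≤ 1 → ∑' n, c n * z ^ n = 0) : c n = 0 := by
  induction n generalizing c with
  | zero => exact coeff_zero_eq_zero_of_tsum_mul_pow_eq_zero hc h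
  | succ n ih =>
    refine ih (c := fun n => c (n + 1)) ((summable_nat_add_iff 1).mpr hc) fun z hz hz1 => ?_
    have hs : Summable fun n => c n * z ^ n := by
      refine Summable.of_norm_bounded hc fun n => ?_
      rw [norm_mul, norm_pow, Real.norm_eq_abs, Real.norm_eq_abs, abs_of_pos hz]
      exact mul_le_of_le_one_right (abs_nonneg _) (pow_le_one₀ hz.le hz1)
    have hsum := hs.tsum_eq_zero_add
    rw [h z hz hz1, coeff_zero_eq_zero_of_tsum_mul_pow_eq_zero hc h, zero_mul, zero_add] at hsum
    have hfactor : ∑' n, c (n + 1) * z ^ (n + 1) = z * ∑' n, c (n + 1) * z ^ n := by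
      rw [← tsum_mul_left]
      exact tsum_congr fun n => by ring
    rw [hfactor] at hsum
    exact (mul_eq_zero.mp hsum.symm).resolve_left hz.ne'

/-- Integration against a measure carried by the range of an injective sequence. -/
theorem hasSum_integral_of_measure_compl_range_eq_zero {α : Type*} [MeasurableSpace α]
    [MeasurableSingletonClass α] {μ : Measure α} {p : ℕ → α} (hp : Function.Injective p)
    (hμ : μ (Set.range p)ᶜ = 0) {f : α → ℝ} (hf : Integrable f μ) :
    HasSum (fun n => μ.real {p n} * f (p n)) (∫ y, f y ∂μ) := by
  have hsum := hasSum_integral_iUnion (μ := μ) (f := f) (s := fun n => {p n})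
    (fun n => measurableSet_singleton _)
    (fun i j hij => by simpa using hp.ne hij) hf.integrableOn
  have hrestrict : μ.restrict (⋃ n, {p n}) = μ := by
    rw [Set.iUnion_singleton_eq_range]
    exact Measure.restrict_eq_self_of_ae_mem (mem_ae_iff.mpr hμ)
  rw [hrestrict] at hsum
  simpa [integral_singleton, measureReal_def] using hsum

/-- The points `h, -h, -2h, …`. -/
def upwardSkipFreePoint (h : ℝ) : ℕ → ℝ
  | 0 => h
  | k + 1 => -((k : ℝ) + 1) * h

theorem upwardSkipFreePoint_injective {h : ℝ} (hh : 0 < h) :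
    Function.Injective (upwardSkipFreePoint h) := by
  have hne : ∀ k : ℕ, h ≠ -((k : ℝ) + 1) * h := fun k hk => by
    have : 0 ≤ (k : ℝ) * h := by positivity
    nlinarith
  rintro (_ | i) (_ | j) hij
  · rfl
  · exact absurd hij (hne j)
  · exact absurd hij.symm (hne i)
  · have := mul_right_cancel₀ hh.ne' hij
    have hcast : (i : ℝ) = j := by linarith
    rw [Nat.cast_injective hcast]

theorem measure_compl_range_upwardSkipFreePoint {h : ℝ} (hh : 0 < h) {lam : Measure ℝ}
    [IsFiniteMeasure lam] (hzero : lam {0} = 0)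
    (hsupp : lam {y : ℝ | ∀ k : ℤ, y ≠ k * h} = 0)
    (hIoi : lam (Set.Ioi (0 : ℝ)) = lam {h}) :
    lam (Set.range (upwardSkipFreePoint h))ᶜ = 0 := by
  have hpos : lam (Set.Ioi (0 : ℝ) \ {h}) = 0 := by
    rw [measure_sdiff (by simpa using hh) (measurableSet_singleton h).nullMeasurableSet
      (measure_ne_top _ _), hIoi, tsub_self]
  refine measure_mono_null ?_ (measure_union_null (measure_union_null hzero hsupp) hpos)
  intro y hy
  by_cases hlat : ∀ k : ℤ, y ≠ k * h
  · exact Or.inl (Or.inr hlat)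
  push Not at hlat
  obtain ⟨k, rfl⟩ := hlat
  rcases lt_trichotomy k 0 with hk | rfl | hk
  · refine absurd ⟨(-k - 1).toNat + 1, ?_⟩ hy
    have hcast : (((-k - 1).toNat : ℤ) : ℝ) = -k - 1 := by
      rw [Int.toNat_of_nonneg (by lia)]
      push_cast
      ring
    rw [Int.cast_natCast] at hcast
    simp only [upwardSkipFreePoint, hcast]
    ring
  · exact Or.inl (Or.inl (by simp))
  · refine Or.inr ⟨mul_pos (Int.cast_pos.mpr hk) hh, fun hmem => hy ⟨0, ?_⟩⟩
    exact (Set.mem_singleton_iff.mp hmem).symm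

theorem integrable_exp_mul_of_nonneg {h β : ℝ} (hβ : 0 ≤ β) {lam : Measure ℝ}
    [IsFiniteMeasure lam] (hle : ∀ᵐ y ∂lam, y ≤ h) :
    Integrable (fun y => Real.exp (β * y)) lam := by
  refine Integrable.of_bound (by fun_prop) (Real.exp (β * h)) ?_
  filter_upwards [hle] with y hy
  rw [Real.norm_eq_abs, Real.abs_exp]
  gcongr

/-- The coefficients of `z * (ψ(β) - φ(β) (e ^ (β h) - x))` as a power series in
`z = e ^ (-β h)`. -/
noncomputable def defectCoeff (h x q : ℝ) (φ : ℕ → ℝ) (lam : Measure ℝ) : ℕ → ℝ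
  | 0 => lam.real {h} - (q + ∑' k : ℕ, φ (k + 1))
  | 1 => x * (q + ∑' k : ℕ, φ (k + 1)) + φ 1 - lam.real Set.univ
  | k + 2 => lam.real {-((k : ℝ) + 1) * h} - (x * φ (k + 1) - φ (k + 2))

theorem summable_abs_defectCoeff {h : ℝ} (x q : ℝ) (hh : 0 < h) {φ : ℕ → ℝ}
    (hsummable : Summable fun k : ℕ => φ (k + 1)) {lam : Measure ℝ} [IsFiniteMeasure lam]
    (hcompl : lam (Set.range (upwardSkipFreePoint h))ᶜ = 0) :
    Summable fun n => |defectCoeff h x q φ lam n| := by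
  have hmass : Summable fun k : ℕ => lam.real {-((k : ℝ) + 1) * h} := by
    have hsum := hasSum_integral_of_measure_compl_range_eq_zero
      (upwardSkipFreePoint_injective hh) hcompl (integrable_const (1 : ℝ))
    simpa [upwardSkipFreePoint] using (summable_nat_add_iff 1).mpr hsum.summable
  have hφ_succ : Summable fun k : ℕ => φ (k + 2) := (summable_nat_add_iff 1).mpr hsummable
  have htail : Summable fun k : ℕ => defectCoeff h x q φ lam (k + 2) := by
    simp only [defectCoeff]
    exact hmass.sub ((hsummable.mul_left x).sub hφ_succ)
  exact ((summable_nat_add_iff 2).mp htail).abs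

theorem hasSum_defectCoeff_mul_pow {h : ℝ} (x q : ℝ) (hh : 0 < h) {φ : ℕ → ℝ}
    (hφ : ∀ k : ℕ, 0 ≤ φ (k + 1)) (hsummable : Summable fun k : ℕ => φ (k + 1))
    {lam : Measure ℝ} [IsFiniteMeasure lam]
    (hcompl : lam (Set.range (upwardSkipFreePoint h))ᶜ = 0) {β : ℝ} (hβ : 0 ≤ β) :
    HasSum (fun n => defectCoeff h x q φ lam n * Real.exp (-β * h) ^ n)
      (Real.exp (-β * h) * ((∫ y : ℝ, (Real.exp (β * y) - 1) ∂lam)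
        - (q + ∑' k : ℕ, φ (k + 1) * (1 - Real.exp (-β * ((k : ℝ) + 1) * h)))
          * (Real.exp (β * h) - x))) := by
  have hinj := upwardSkipFreePoint_injective hh
  have hle : ∀ᵐ y ∂lam, y ≤ h := by
    filter_upwards [mem_ae_iff.mpr hcompl]
    rintro _ ⟨_ | k, rfl⟩
    · exact le_rfl
    · have : 0 ≤ (k : ℝ) * h := by positivity
      simp only [upwardSkipFreePoint]
      nlinarith
  set z := Real.exp (-β * h) with hz
  have hexp : ∀ k : ℕ, Real.exp (-β * ((k : ℝ) + 1) * h) = z ^ (k + 1) := fun k => by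
    rw [hz, ← Real.exp_nat_mul]
    push_cast
    ring_nf
  have hexp' : ∀ k : ℕ, Real.exp (β * (-((k : ℝ) + 1) * h)) = z ^ (k + 1) := fun k => by
    rw [← hexp]
    ring_nf
  have hinv : z * Real.exp (β * h) = 1 := by
    rw [hz, ← Real.exp_add]
    simp
  have hz0 : 0 < z := Real.exp_pos _
  have hz1 : z ≤ 1 := Real.exp_le_one_iff.mpr (by nlinarith)
  have hint := integrable_exp_mul_of_nonneg hβ hle
  have hψ : ∫ y : ℝ, (Real.exp (β * y) - 1) ∂lam
      = (∫ y : ℝ, Real.exp (β * y) ∂lam) - lam.real Set.univ := by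
    rw [integral_sub hint (integrable_const 1)]
    simp
  have hE := (hasSum_nat_add_iff' 1).mpr
    (hasSum_integral_of_measure_compl_range_eq_zero hinj hcompl hint)
  simp only [Finset.range_one, Finset.sum_singleton, upwardSkipFreePoint, hexp'] at hE
  have hφz : Summable fun k : ℕ => φ (k + 1) * z ^ (k + 1) := by
    refine Summable.of_nonneg_of_le (fun k => mul_nonneg (hφ k) (by positivity))
      (fun k => ?_) hsummable
    exact mul_le_of_le_one_right (hφ k) (pow_le_one₀ hz0.le hz1)
  have hφtsum : ∑' k : ℕ, φ (k + 1) * (1 - Real.exp (-β * ((k : ℝ) + 1) * h))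
      = (∑' k : ℕ, φ (k + 1)) - ∑' k : ℕ, φ (k + 1) * z ^ (k + 1) := by
    rw [← hsummable.tsum_sub hφz]
    exact tsum_congr fun k => by rw [hexp]; ring
  have hT := hφz.hasSum
  have hT' := (hasSum_nat_add_iff' 1).mpr hT
  simp only [Finset.range_one, Finset.sum_singleton] at hT'
  rw [hφtsum, hψ, ← hasSum_nat_add_iff' 2]
  convert (hE.mul_left z).sub ((hT.mul_left (x * z)).sub hT') using 1
  · funext k
    simp only [defectCoeff]
    ring
  · simp only [Finset.sum_range_succ, Finset.sum_range_zero, defectCoeff]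
    linear_combination (-lam.real {h} + q + (∑' k : ℕ, φ (k + 1)) -
      ∑' k : ℕ, φ (k + 1) * z ^ (k + 1)) * (-hinv)

/-- The functional equation `ψ(β) = φ(β)·(e^{βh} − x)` (for all `β ≥ 0`) holds if and only if
(1) `q + Σ_{k≥1} φ_k = λ({h})`, (2) `x·(q + Σ_{k≥1} φ_k) + φ_1 = λ(ℝ)` and
(3) `x·φ_k − φ_{k+1} = λ({−kh})` for every `k ≥ 1`.  Here `φ (k+1)` plays the role of `φ_k`. -/
theorem stmt8 (h x q : ℝ) (hh : 0 < h) (hx : 0 < x) (hq : 0 ≤ q)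
    (φ : ℕ → ℝ) (hφ : ∀ k : ℕ, 0 ≤ φ (k + 1))
    (hsummable : Summable (fun k : ℕ => φ (k + 1)))
    (lam : Measure ℝ) [IsFiniteMeasure lam]
    (hzero : lam {0} = 0)
    (hsupp : lam {y : ℝ | ∀ k : ℤ, y ≠ k * h} = 0)
    (hIoi : lam (Set.Ioi (0 : ℝ)) = lam {h}) :
    (∀ β : ℝ, 0 ≤ β →
        (∫ y : ℝ, (Real.exp (β * y) - 1) ∂lam)
          = (q + ∑' k : ℕ, φ (k + 1) * (1 - Real.exp (-β * ((k : ℝ) + 1) * h)))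
            * (Real.exp (β * h) - x)) ↔
      ((q + ∑' k : ℕ, φ (k + 1) = (lam {h}).toReal) ∧
        (x * (q + ∑' k : ℕ, φ (k + 1)) + φ 1 = (lam Set.univ).toReal) ∧
        (∀ k : ℕ, x * φ (k + 1) - φ (k + 2) = (lam {-((k : ℝ) + 1) * h}).toReal)) := by
  have hcompl := measure_compl_range_upwardSkipFreePoint hh hzero hsupp hIoi
  have hcoeff := summable_abs_defectCoeff x q hh hsummable hcompl
  have hpow : ∀ β : ℝ, 0 ≤ β → _ := fun β hβ =>
    hasSum_defectCoeff_mul_pow x q hh hφ hsummable hcompl hβ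
  calc
    _ ↔ ∀ n, defectCoeff h x q φ lam n = 0 := by
      constructor
      · intro H n
        refine coeff_eq_zero_of_tsum_mul_pow_eq_zero n hcoeff fun z hz hz1 => ?_
        have hβ : 0 ≤ -Real.log z / h :=
          div_nonneg (neg_nonneg.mpr (Real.log_nonpos hz.le hz1)) hh.le
        have hzβ : Real.exp (-(-Real.log z / h) * h) = z := by
          rw [show -(-Real.log z / h) * h = Real.log z by field_simp, Real.exp_log hz]
        have hsum := (hpow _ hβ).tsum_eq
        rwa [sub_eq_zero.mpr (H _ hβ), mul_zero, hzβ] at hsum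
      · intro H β hβ
        have hsum := hpow β hβ
        simp only [H, zero_mul] at hsum
        exact sub_eq_zero.mp
          ((mul_eq_zero.mp (hsum.unique hasSum_zero)).resolve_left (Real.exp_pos _).ne')
    _ ↔ _ := by
      constructor
      · exact fun H => ⟨(sub_eq_zero.mp (H 0)).symm, sub_eq_zero.mp (H 1),
          fun k => (sub_eq_zero.mp (H (k + 2))).symm⟩
      · rintro ⟨h0, h1, h2⟩ (_ | _ | k)
        · exact sub_eq_zero.mpr h0.symm
        · exact sub_eq_zero.mpr h1
        · exact sub_eq_zero.mpr (h2 k).symm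
end

section
/- For every n ≥ 0 the following two identities hold: W(n+1) = W(0) + Σ_{k=1}^{n+1} W(n+1−k)·(q + γ·Σ_{l=k}^{∞} q_l)/(p·γ), and Z̃(n+1) = (n+1)·q/(p·γ) + Σ_{k=1}^{n} Z̃(n+1−k)·(q + γ·Σ_{l=k}^{∞} q_l)/(p·γ), where Z̃(n) := q·Σ_{j=0}^{n−1} W(j) for n ≥ 0 (so Z̃ = Z^{(q)} − 1 and Z̃(0) = 0). -/
/-- Summation by parts: a linear recursion with weights `a i = c i - c (i + 1)` implies its
cumulative form with weights `c`. -/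
theorem eq_add_sum_of_sub_recursion (w c a : ℕ → ℝ) (hc : ∀ i, c (i + 1) = c i - a i)
    (hw : ∀ n, w (n + 1) = (1 + c 0) * w n - ∑ i ∈ Finset.range n, a i * w (n - (i + 1)))
    (n : ℕ) : w (n + 1) = w 0 + ∑ i ∈ Finset.range (n + 1), w (n - i) * c i := by
  induction n with
  | zero => simp [hw 0]; ring
  | succ n ih =>
    have hsum : ∑ i ∈ Finset.range (n + 1), w (n + 1 - (i + 1)) * c (i + 1)
        = ∑ i ∈ Finset.range (n + 1), w (n - i) * c i
          - ∑ i ∈ Finset.range (n + 1), a i * w (n + 1 - (i + 1)) := by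
      rw [← Finset.sum_sub_distrib]
      refine Finset.sum_congr rfl fun i _ => ?_
      rw [hc, Nat.add_sub_add_right]
      ring
    rw [hw (n + 1), Finset.sum_range_succ' (fun i => w (n + 1 - i) * c i), hsum, Nat.sub_zero]
    linarith

/-- The partial sums of a solution of a renewal equation with constant forcing solve the renewal
equation with linear forcing. -/
theorem sum_range_eq_of_renewal (w c : ℕ → ℝ)
    (hw : ∀ n, w (n + 1) = w 0 + ∑ i ∈ Finset.range (n + 1), w (n - i) * c i) (n : ℕ) :
    ∑ j ∈ Finset.range (n + 1), w j
      = ((n : ℝ) + 1) * w 0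
        + ∑ i ∈ Finset.range n, (∑ j ∈ Finset.range (n - i), w j) * c i := by
  induction n with
  | zero => simp
  | succ n ih =>
    have hsum : ∑ i ∈ Finset.range (n + 1), (∑ j ∈ Finset.range (n + 1 - i), w j) * c i
        = ∑ i ∈ Finset.range n, (∑ j ∈ Finset.range (n - i), w j) * c i
          + ∑ i ∈ Finset.range (n + 1), w (n - i) * c i := by
      have hlast : ∑ i ∈ Finset.range n, (∑ j ∈ Finset.range (n - i), w j) * c i
          = ∑ i ∈ Finset.range (n + 1), (∑ j ∈ Finset.range (n - i), w j) * c i := by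
        simp [Finset.sum_range_succ _ n]
      rw [hlast, ← Finset.sum_add_distrib]
      refine Finset.sum_congr rfl fun i hi => ?_
      rw [Nat.sub_add_comm (Finset.mem_range_succ_iff.mp hi), Finset.sum_range_succ]
      ring
    rw [Finset.sum_range_succ, ih, hw n, hsum]
    push_cast
    ring

theorem sum_Icc_one_eq_sum_range (f : ℕ → ℝ) (n : ℕ) :
    ∑ k ∈ Finset.Icc 1 n, f k = ∑ i ∈ Finset.range n, f (i + 1) := by
  rw [Finset.range_eq_Ico, Finset.sum_Ico_add' f 0 n 1]
  rfl

/-- Alternative (cumulative) form of the recursions for the scale functions `W^{(q)}` and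
`Z^{(q)} − 1` of an upwards skip-free Lévy chain with jump rate `γ`, up-jump probability `p`
and down-jump probabilities `q_l`:
`W(n+1) = W(0) + Σ_{k=1}^{n+1} W(n+1−k)·(q + γ·Σ_{l≥k} q_l)/(pγ)` and
`Z̃(n+1) = (n+1)·q/(pγ) + Σ_{k=1}^{n} Z̃(n+1−k)·(q + γ·Σ_{l≥k} q_l)/(pγ)`,
where `Z̃(n) = q·Σ_{j=0}^{n−1} W(j)`.  Here `ql (l+1)` plays the role of `q_l` (`l ≥ 1`). -/
theorem stmt17 (γ q p : ℝ) (hγ : 0 < γ) (hq : 0 ≤ q) (hp0 : 0 < p) (hp1 : p ≤ 1)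
    (ql : ℕ → ℝ) (hql : ∀ l : ℕ, 0 ≤ ql (l + 1))
    (hqsum : HasSum (fun l : ℕ => ql (l + 1)) (1 - p))
    (W : ℤ → ℝ) (hWneg : ∀ k : ℤ, k < 0 → W k = 0) (hW0 : W 0 = 1 / (γ * p))
    (hWrec : ∀ k : ℕ,
      p * W ((k : ℤ) + 1)
        = (1 + q / γ) * W (k : ℤ) - ∑ l ∈ Finset.Icc 1 k, ql l * W ((k : ℤ) - (l : ℤ))) :
    (∀ n : ℕ,
      W ((n : ℤ) + 1)
        = W 0 + ∑ k ∈ Finset.Icc 1 (n + 1),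
            W ((n : ℤ) + 1 - (k : ℤ)) * ((q + γ * ∑' l : ℕ, ql (k + l)) / (p * γ))) ∧
    (∀ n : ℕ,
      q * ∑ j ∈ Finset.range (n + 1), W (j : ℤ)
        = ((n : ℝ) + 1) * (q / (p * γ))
          + ∑ k ∈ Finset.Icc 1 n,
              (q * ∑ j ∈ Finset.range (n + 1 - k), W (j : ℤ))
                * ((q + γ * ∑' l : ℕ, ql (k + l)) / (p * γ))) := by
  set c : ℕ → ℝ := fun i => (q + γ * ∑' l : ℕ, ql (i + 1 + l)) / (p * γ) with hcdef
  have hc : ∀ i, c (i + 1) = c i - ql (i + 1) / p := by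
    intro i
    have hsummable : Summable fun l : ℕ => ql (i + 1 + l) := by
      refine ((summable_nat_add_iff i).mpr hqsum.summable).congr fun l => ?_
      congr 1
      omega
    have htail : ∑' l : ℕ, ql (i + 1 + l) = ql (i + 1) + ∑' l : ℕ, ql (i + 1 + 1 + l) := by
      rw [hsummable.tsum_eq_zero_add]
      congr 2
      funext l
      congr 1
      omega
    simp only [hcdef]
    rw [htail]
    field_simp
    ring
  have hc0 : c 0 = (q + γ * (1 - p)) / (p * γ) := by
    simp only [hcdef]
    rw [← hqsum.tsum_eq]
    simp only [zero_add, add_comm 1]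
  have hrenewal := eq_add_sum_of_sub_recursion (fun n : ℕ => W n) c (fun i => ql (i + 1) / p) hc
    (by
      intro n
      have hsum : ∑ i ∈ Finset.range n, ql (i + 1) / p * W ((n - (i + 1) : ℕ) : ℤ)
          = (∑ l ∈ Finset.Icc 1 n, ql l * W ((n : ℤ) - (l : ℤ))) / p := by
        rw [sum_Icc_one_eq_sum_range, Finset.sum_div]
        refine Finset.sum_congr rfl fun i hi => ?_
        rw [Nat.cast_sub (Finset.mem_range.mp hi)]
        ring
      have hrec := hWrec n
      simp only [hsum, hc0]
      push_cast
      rw [← mul_right_inj' hp0.ne', hrec]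
      field_simp
      ring)
  refine ⟨fun n => ?_, fun n => ?_⟩
  · have h := hrenewal n
    push_cast at h
    rw [h, sum_Icc_one_eq_sum_range]
    congr 1
    refine Finset.sum_congr rfl fun i hi => ?_
    rw [Nat.cast_sub (Finset.mem_range_succ_iff.mp hi)]
    push_cast
    rw [add_sub_add_right_eq_sub]
  · rw [sum_range_eq_of_renewal (fun n : ℕ => W n) c hrenewal n, sum_Icc_one_eq_sum_range,
      mul_add, Finset.mul_sum]
    congr 1
    · simp only [Nat.cast_zero, hW0]
      field_simp
    · refine Finset.sum_congr rfl fun i _ => ?_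
      rw [Nat.add_sub_add_right, mul_assoc]
end

section
/- Let q ≥ 0 and let Φq ∈ [0,∞) satisfy ψ(Φq) = q and ψ(β) > q for every β > Φq (Φq is the largest root of ψ = q). Put γ := λ(ℝ), p := λ({h})/γ and q_l := λ({−lh})/γ for l ≥ 1. Let (w_k)_{k≥0} be the real sequence determined by w_0 = 1/(h·λ({h})) and p·w_{k+1} = (1 + q/γ)·w_k − Σ_{l=1}^{k} q_l·w_{k−l} for k ≥ 0, and assume Σ_{k≥0} |w_k|·e^{−βkh} < ∞ for every β > Φq. Define W^{(q)}(x) := w_{⌊x/h⌋} for x ≥ 0. Then for every β > Φq: ∫_0^∞ e^{−βx}·W^{(q)}(x) dx = (e^{βh} − 1)/(β·h·(ψ(β) − q)). -/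
open MeasureTheory

open Set in
/-- Integral of an exponential against a finite measure carried by the points `(1 - n) * h`. -/
theorem integrable_and_hasSum_exp_of_skipFree {h : ℝ} (hh : 0 < h) {lam : Measure ℝ}
    [IsFiniteMeasure lam]
    (hsupp : lam {x : ℝ | ∀ k : ℤ, x ≠ k * h} = 0)
    (hIoi : lam (Set.Ioi (0 : ℝ)) = lam {h}) {β : ℝ} (hβ : 0 ≤ β) :
    Integrable (fun x => Real.exp (β * x)) lam ∧
      HasSum (fun n : ℕ => lam.real {(1 - n) * h} * Real.exp (β * ((1 - n) * h)))
        (∫ x, Real.exp (β * x) ∂lam) := by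
  have hdiff : lam (Ioi 0 \ {h}) = 0 := by
    rw [measure_sdiff (by simpa using hh) (measurableSet_singleton h).nullMeasurableSet
      (measure_ne_top _ _), hIoi, tsub_self]
  have hae : ∀ᵐ x ∂lam, ∃ n : ℕ, x = (1 - n) * h := by
    have h1 : ∀ᵐ x ∂lam, x ∉ Ioi 0 \ {h} := measure_eq_zero_iff_ae_notMem.1 hdiff
    have h2 : ∀ᵐ x ∂lam, x ∉ {x : ℝ | ∀ k : ℤ, x ≠ k * h} := measure_eq_zero_iff_ae_notMem.1 hsupp
    filter_upwards [h1, h2] with x hx1 hx2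
    simp only [not_forall, not_not] at hx2
    obtain ⟨k, rfl⟩ := hx2
    have hk : k ≤ 1 := by
      by_contra! hk
      have hk' : (1 : ℝ) < k := by exact_mod_cast hk
      refine hx1 ⟨mul_pos (by linarith) hh, fun hk1 => ?_⟩
      rw [mem_singleton_iff] at hk1
      nlinarith
    obtain ⟨n, hn⟩ := Int.eq_ofNat_of_zero_le (sub_nonneg.2 hk)
    refine ⟨n, ?_⟩
    have : k = 1 - (n : ℤ) := by lia
    rw [this]; push_cast; rfl
  have hint : Integrable (fun x => Real.exp (β * x)) lam := by
    refine Integrable.of_bound (by fun_prop) (Real.exp (β * h)) ?_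
    filter_upwards [hae] with x hx
    obtain ⟨n, rfl⟩ := hx
    rw [Real.norm_eq_abs, Real.abs_exp, Real.exp_le_exp]
    have : (0 : ℝ) ≤ n * h := by positivity
    nlinarith
  refine ⟨hint, ?_⟩
  have hdisj : Pairwise (Function.onFun Disjoint fun n : ℕ => ({(1 - (n : ℝ)) * h} : Set ℝ)) := by
    intro m n hmn
    simpa [Function.onFun, hh.ne'] using hmn
  have key := hasSum_integral_iUnion (μ := lam)
    (s := fun n : ℕ => ({(1 - (n : ℝ)) * h} : Set ℝ)) (f := fun x => Real.exp (β * x))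
    (fun n => measurableSet_singleton _) hdisj hint.integrableOn
  have huniv : lam.restrict (⋃ n : ℕ, ({(1 - (n : ℝ)) * h} : Set ℝ)) = lam := by
    refine Measure.restrict_eq_self_of_ae_mem ?_
    filter_upwards [hae] with x hx
    simpa [eq_comm] using hx
  rw [huniv] at key
  simpa only [integral_singleton, smul_eq_mul] using key

open Set in
/-- Laplace transform of a step function with steps of length `h`. -/
theorem integral_exp_mul_step {h β : ℝ} (hh : 0 < h) (hβ : 0 < β) {w : ℕ → ℝ}
    (hw : Summable fun k : ℕ => |w k| * Real.exp (-β * k * h)) :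
    (∫ x in Ioi (0 : ℝ), Real.exp (-β * x) * w (⌊x / h⌋.toNat))
      = (∑' k : ℕ, w k * Real.exp (-β * k * h)) * ((1 - Real.exp (-β * h)) / β) := by
  have hset : ∀ k : ℕ, ∀ x ∈ Ico (k * h) ((k + 1) * h), ⌊x / h⌋.toNat = k := by
    intro k x hx
    have : ⌊x / h⌋ = (k : ℤ) := by
      rw [Int.floor_eq_iff, le_div_iff₀ hh, div_lt_iff₀ hh]
      exact_mod_cast hx
    simp [this]
  have hU : ⋃ k : ℕ, Ico ((k : ℝ) * h) ((k + 1) * h) = Ici 0 := by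
    ext x
    simp only [mem_iUnion, mem_Ico, mem_Ici]
    constructor
    · rintro ⟨k, hk, -⟩
      exact le_trans (by positivity) hk
    · intro hx
      refine ⟨⌊x / h⌋₊, ?_, ?_⟩
      · rw [← le_div_iff₀ hh]; exact Nat.floor_le (by positivity)
      · rw [← div_lt_iff₀ hh]; exact Nat.lt_floor_add_one _
  have hdisj : Pairwise (Function.onFun Disjoint fun k : ℕ => Ico ((k : ℝ) * h) ((k + 1) * h)) := by
    intro m n hmn
    refine Set.disjoint_left.2 fun x hm hn => hmn ?_
    rw [← hset m x hm, hset n x hn]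
  have hexp : ∀ k : ℕ, ∫ x in Ico ((k : ℝ) * h) ((k + 1) * h), Real.exp (-β * x)
      = Real.exp (-β * k * h) * ((1 - Real.exp (-β * h)) / β) := by
    intro k
    rw [integral_Ico_eq_integral_Ioc, ← intervalIntegral.integral_of_le (by nlinarith),
      intervalIntegral.integral_comp_mul_left (fun x => Real.exp x) (neg_ne_zero.2 hβ.ne'),
      integral_exp, smul_eq_mul,
      show -β * ((k + 1) * h) = -β * k * h + -β * h by ring, Real.exp_add,
      show -β * (k * h) = -β * k * h by ring]
    field_simp
    ring
  have hval : ∀ (c : ℕ → ℝ) (k : ℕ),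
      ∫ x in Ico ((k : ℝ) * h) ((k + 1) * h), Real.exp (-β * x) * c (⌊x / h⌋.toNat)
      = c k * Real.exp (-β * k * h) * ((1 - Real.exp (-β * h)) / β) := by
    intro c k
    rw [setIntegral_congr_fun (g := fun x => Real.exp (-β * x) * c k) measurableSet_Ico
      (fun x hx => by simp only [hset k x hx]), integral_mul_const, hexp]
    ring
  have hint : IntegrableOn (fun x => Real.exp (-β * x) * w (⌊x / h⌋.toNat))
      (⋃ k : ℕ, Ico ((k : ℝ) * h) ((k + 1) * h)) := by
    refine integrableOn_iUnion_of_summable_integral_norm (fun k => ?_) ?_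
    · refine IntegrableOn.congr_fun (f := fun x => Real.exp (-β * x) * w k) ?_
        (fun x hx => by simp only [hset k x hx]) measurableSet_Ico
      exact (Continuous.integrableOn_Icc (by fun_prop)).mono_set Ico_subset_Icc_self
    · simp only [norm_mul, Real.norm_eq_abs, Real.abs_exp, hval (fun k => |w k|)]
      exact hw.mul_right _
  have key := hasSum_integral_iUnion (fun k : ℕ => measurableSet_Ico) hdisj hint
  rw [hU, integral_Ici_eq_integral_Ioi] at key
  rw [← key.tsum_eq, ← tsum_mul_right]
  exact tsum_congr (hval w)


/-- The `q`-scale function `W^{(q)}(x) = w_{⌊x/h⌋}` of an upwards skip-free Lévy chain,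
determined by `w_0 = 1/(h·λ({h}))` and the recursion
`p·w_{k+1} = (1 + q/γ)·w_k − Σ_{l=1}^k q_l·w_{k−l}` (`γ = λ(ℝ)`, `p = λ({h})/γ`,
`q_l = λ({−lh})/γ`), has Laplace transform
`∫_0^∞ e^{−βx} W^{(q)}(x) dx = (e^{βh} − 1)/(βh(ψ(β) − q))` for `β > Φ(q)`. -/
theorem stmt18 (h : ℝ) (hh : 0 < h) (lam : Measure ℝ) [IsFiniteMeasure lam] (hne : lam ≠ 0)
    (hzero : lam {0} = 0)
    (hsupp : lam {x : ℝ | ∀ k : ℤ, x ≠ k * h} = 0)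
    (hIoi : lam (Set.Ioi (0 : ℝ)) = lam {h}) (hath : 0 < lam {h})
    (q : ℝ) (hq : 0 ≤ q)
    (Φq : ℝ) (hΦq0 : 0 ≤ Φq)
    (hroot : (∫ x : ℝ, (Real.exp (Φq * x) - 1) ∂lam) = q)
    (hlargest : ∀ β : ℝ, Φq < β → q < ∫ x : ℝ, (Real.exp (β * x) - 1) ∂lam)
    (w : ℕ → ℝ) (hw0 : w 0 = 1 / (h * (lam {h}).toReal))
    (hwrec : ∀ k : ℕ,
      ((lam {h}).toReal / (lam Set.univ).toReal) * w (k + 1)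
        = (1 + q / (lam Set.univ).toReal) * w k
          - ∑ l ∈ Finset.Icc 1 k,
              ((lam {-(l : ℝ) * h}).toReal / (lam Set.univ).toReal) * w (k - l))
    (hsummable : ∀ β : ℝ, Φq < β →
      Summable (fun k : ℕ => |w k| * Real.exp (-β * k * h))) :
    ∀ β : ℝ, Φq < β →
      (∫ x in Set.Ioi (0 : ℝ), Real.exp (-β * x) * w (⌊x / h⌋.toNat))
        = (Real.exp (β * h) - 1)
          / (β * h * ((∫ x : ℝ, (Real.exp (β * x) - 1) ∂lam) - q)) := by
  intro β hβ
  have hβ0 : 0 < β := hΦq0.trans_lt hβ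
  rw [integral_exp_mul_step hh hβ0 (hsummable β hβ)]
  obtain ⟨hint, hsum⟩ := integrable_and_hasSum_exp_of_skipFree hh hsupp hIoi hβ0.le
  have hψ := hlargest β hβ
  rw [integral_sub hint (integrable_const _), integral_const, smul_eq_mul, mul_one] at hψ ⊢
  have hA : 0 < lam.real {h} := ENNReal.toReal_pos hath.ne' (measure_ne_top _ _)
  have hγ : 0 < lam.real Set.univ :=
    hA.trans_le (measureReal_mono (Set.subset_univ _))
  set z := Real.exp (-β * h) with hz
  have hz0 : 0 < z := Real.exp_pos _
  have hzpow : ∀ k : ℕ, Real.exp (-β * k * h) = z ^ k := fun k => by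
    rw [hz, ← Real.exp_nat_mul]; congr 1; ring
  have hzinv : Real.exp (β * h) = z⁻¹ := by rw [hz, ← Real.exp_neg]; congr 1; ring
  set a : ℕ → ℝ := fun l => lam.real {-(l : ℝ) * h} with ha
  have ha0 : a 0 = 0 := by simp [ha, measureReal_def, hzero]
  have hL : HasSum (fun l => a l * z ^ l)
      ((∫ x, Real.exp (β * x) ∂lam) - lam.real {h} * z⁻¹) := by
    have := (hasSum_nat_add_iff' 1).2 hsum
    simp only [Finset.sum_range_one, Nat.cast_zero, sub_zero, one_mul, hzinv] at this
    refine this.congr_fun fun l => ?_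
    simp only [ha, ← hzpow]
    push_cast
    rw [show (1 - ((l : ℝ) + 1)) * h = -l * h by ring,
      show β * (-l * h) = -β * l * h by ring]
  set I := ∫ x, Real.exp (β * x) ∂lam
  have hwabs := hsummable β hβ
  simp only [hzpow] at hwabs ⊢
  have hwn : Summable fun k => ‖w k * z ^ k‖ := by
    simpa [abs_of_pos hz0] using hwabs
  have han : Summable fun k => ‖a k * z ^ k‖ := hL.summable.norm
  have hprod := tsum_mul_tsum_eq_tsum_sum_range_of_summable_norm han hwn
  have hprodS := (summable_norm_sum_mul_range_of_summable_norm han hwn).of_norm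
  have hrec : ∀ k, lam.real {h} * (w (k + 1) * z ^ (k + 1)) =
      z * ((lam.real Set.univ + q) * (w k * z ^ k)
        - ∑ l ∈ Finset.range (k + 1), a l * z ^ l * (w (k - l) * z ^ (k - l))) := by
    intro k
    have h1 : ∑ l ∈ Finset.range (k + 1), a l * z ^ l * (w (k - l) * z ^ (k - l))
        = z ^ k * ∑ l ∈ Finset.Icc 1 k, a l * w (k - l) := by
      rw [Finset.mul_sum, Finset.sum_range_eq_add_Ico _ (Nat.succ_pos k), ha0, zero_mul, zero_mul,
        zero_add]
      refine Finset.sum_congr (by ext; simp) fun l hl => ?_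
      rw [← Nat.add_sub_of_le (Finset.mem_Icc.1 hl).2, pow_add, Nat.add_sub_cancel_left]
      ring
    have h2 := hwrec k
    simp only [← measureReal_def, div_mul_eq_mul_div, ← Finset.sum_div] at h2
    change _ = _ - (∑ l ∈ Finset.Icc 1 k, a l * w (k - l)) / _ at h2
    generalize ∑ l ∈ Finset.Icc 1 k, a l * w (k - l) = c at h1 h2
    field_simp at h2
    rw [h1, pow_succ]
    linear_combination z ^ k * z * h2
  have hS := hwn.of_norm
  have hshift := hS.tsum_eq_zero_add
  have hw0' : h * lam.real {h} * w 0 = 1 := by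
    rw [hw0, ← measureReal_def]; field_simp
  have htot := tsum_congr (L := .unconditional ℕ) hrec
  rw [tsum_mul_left, tsum_mul_left, (hS.mul_left _).tsum_sub hprodS, tsum_mul_left, ← hprod,
    hL.tsum_eq] at htot
  set S := ∑' k, w k * z ^ k
  rw [eq_sub_of_add_eq' hshift.symm, pow_zero, mul_one] at htot
  have hSD : z * h * (I - lam.real Set.univ - q) * S = 1 := by
    field_simp at htot
    linear_combination hw0' + h * htot
  have hD : I - lam.real Set.univ - q ≠ 0 := (sub_pos.2 hψ).ne'
  rw [hzinv, eq_div_iff (mul_ne_zero (mul_ne_zero hβ0.ne' hh.ne') hD)]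
  field_simp
  linear_combination (1 - z) * hSD
end
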